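/- arXiv:2001.08627 — 3 statements merged into one kernel-verified Lean document; each statement's English description precedes it below -/
import Mathlib

section
/- Let φ be a semiflow on E satisfying (H1), (H2), (H3), (COM) and (S) with nonempty amenable set 𝔄. Then: (i) φ^t(𝔄) = 𝔄 for all t ≥ 0; (ii) for every t ≥ 0 the map φ^t restricted to 𝔄 is a homeomorphism of 𝔄 onto itself; and (iii) defining for t < 0 the map φ^t on 𝔄 as the inverse of φ^{−t}|_𝔄, the map ℝ × 𝔄 → 𝔄, (t,v) ↦ φ^t(v), is continuous, i.e., the restriction of φ to 𝔄 extends to a flow on 𝔄. -/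
open Set Filter Topology MeasureTheory Bornology

/-- A semiflow on a Banach space `E`. -/
structure Semiflow (E : Type*) [NormedAddCommGroup E] [NormedSpace ℝ E] where
  toFun : ℝ → E → E
  map_zero' : ∀ v : E, toFun 0 v = v
  map_add' : ∀ t s : ℝ, 0 ≤ t → 0 ≤ s → ∀ v : E, toFun (t + s) v = toFun t (toFun s v)
  continuousOn' : ContinuousOn (fun p : ℝ × E => toFun p.1 p.2) (Set.Ici (0 : ℝ) ×ˢ Set.univ)

/-- The open `r`-neighborhood `O_r(γ)` of a set `γ` in a normed space. -/
def setNbhd {E : Type*} [NormedAddCommGroup E] (γ : Set E) (r : ℝ) : Set E :=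
  {v | ∃ w ∈ γ, ‖v - w‖ < r}

/-- `S` is an `ε`-section at `x₀` of the (partial) flow `ξ` on the set `M`. -/
def IsSectionOn {X : Type*} [TopologicalSpace X] (M : Set X) (ξ : ℝ → X → X)
    (ε : ℝ) (x₀ : X) (S : Set X) : Prop :=
  x₀ ∈ S ∧ S ⊆ M ∧
    (∃ W : Set X, IsOpen W ∧ x₀ ∈ W ∧
      W ∩ M ⊆ ⋃ t ∈ Set.Icc (-ε) ε, ξ t '' S) ∧
    ∀ y ∈ ⋃ t ∈ Set.Icc (-ε) ε, ξ t '' S,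
      ∃! p : ℝ × X, p.1 ∈ Set.Icc (-ε) ε ∧ p.2 ∈ S ∧ ξ p.1 p.2 = y

/-- `T` is an `ε`-transversal at `x₀` of the (partial) flow `ξ` on the set `M`:
an `ε`-section which is the image of a topological embedding of `[-1,1]`,
with `x₀` corresponding to an interior point. -/
def IsTransversalOn {X : Type*} [TopologicalSpace X] (M : Set X) (ξ : ℝ → X → X)
    (ε : ℝ) (x₀ : X) (T : Set X) : Prop :=
  IsSectionOn M ξ ε x₀ T ∧
    ∃ h : ℝ → X, ContinuousOn h (Set.Icc (-1 : ℝ) 1) ∧ Set.InjOn h (Set.Icc (-1 : ℝ) 1) ∧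
      h '' Set.Icc (-1 : ℝ) 1 = T ∧ ∃ s₀ ∈ Set.Ioo (-1 : ℝ) 1, h s₀ = x₀

namespace Semiflow

variable {E : Type*} [NormedAddCommGroup E] [NormedSpace ℝ E]
variable {H : Type*} [NormedAddCommGroup H] [InnerProductSpace ℝ H]

/-- A stationary point of the semiflow. -/
def IsStationary (φ : Semiflow E) (v₀ : E) : Prop :=
  ∀ t : ℝ, 0 ≤ t → φ.toFun t v₀ = v₀

/-- A periodic (non-stationary) point of the semiflow. -/
def IsPeriodicPt (φ : Semiflow E) (v₀ : E) : Prop :=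
  ¬ φ.IsStationary v₀ ∧ ∃ σ : ℝ, 0 < σ ∧ φ.toFun σ v₀ = v₀

/-- The positive semi-orbit `γ⁺(v₀)` (which equals the full orbit for periodic points). -/
def orbit (φ : Semiflow E) (v₀ : E) : Set E :=
  {w | ∃ t : ℝ, 0 ≤ t ∧ φ.toFun t v₀ = w}

/-- `γ` is a periodic orbit of the semiflow. -/
def IsPeriodicOrbit (φ : Semiflow E) (γ : Set E) : Prop :=
  ∃ v₀ : E, φ.IsPeriodicPt v₀ ∧ γ = φ.orbit v₀

/-- The ω-limit set of a point. -/
def omegaLimit (φ : Semiflow E) (v₀ : E) : Set E :=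
  ⋂ s ∈ Set.Ici (0 : ℝ), closure {w | ∃ t : ℝ, s ≤ t ∧ φ.toFun t v₀ = w}

/-- A complete trajectory of the semiflow. -/
def IsCompleteTrajectory (φ : Semiflow E) (v : ℝ → E) : Prop :=
  Continuous v ∧ ∀ t : ℝ, 0 ≤ t → ∀ s : ℝ, v (t + s) = φ.toFun t (v s)

/-- The α-limit set of a complete trajectory. -/
def alphaLimitOf (φ : Semiflow E) (v : ℝ → E) : Set E :=
  ⋂ s ∈ Set.Iic (0 : ℝ), closure {w | ∃ t : ℝ, t ≤ s ∧ v t = w}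

/-- Hypothesis (H1): `P` is symmetric and positive on `Eplus`, negative on `Eminus`,
with `E = Eplus ⊕ Eminus`. -/
def IsH1 (P : E →L[ℝ] E →L[ℝ] ℝ) (Eplus Eminus : Submodule ℝ E) : Prop :=
  (∀ v w : E, P v w = P w v) ∧ IsClosed (Eplus : Set E) ∧ IsClosed (Eminus : Set E) ∧
    IsCompl Eplus Eminus ∧
    (∀ v ∈ Eplus, v ≠ 0 → 0 < P v v) ∧ (∀ v ∈ Eminus, v ≠ 0 → P v v < 0)

/-- Hypothesis (H3): squeezing with respect to `V(v) = ⟨v, Pv⟩`, with parameters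
`δ > 0`, `τV ≥ 0`, `ν > 0`; the embedding `E ↪ H` is `ι`. -/
def IsH3 (φ : Semiflow E) (ι : E →L[ℝ] H) (P : E →L[ℝ] E →L[ℝ] ℝ) (δ τV ν : ℝ) : Prop :=
  0 < δ ∧ 0 ≤ τV ∧ 0 < ν ∧
    ∀ v₁ v₂ : E, ∀ l r : ℝ, 0 ≤ l → l ≤ r → τV ≤ r - l →
      Real.exp (2 * ν * r) *
          P (φ.toFun r v₁ - φ.toFun r v₂) (φ.toFun r v₁ - φ.toFun r v₂) -
        Real.exp (2 * ν * l) *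
          P (φ.toFun l v₁ - φ.toFun l v₂) (φ.toFun l v₁ - φ.toFun l v₂) ≤
      -δ * ∫ s in l..r, Real.exp (2 * ν * s) * ‖ι (φ.toFun s v₁) - ι (φ.toFun s v₂)‖ ^ 2

/-- Hypothesis (COM): some time-`τ` map takes bounded sets to precompact sets. -/
def IsCOM (φ : Semiflow E) : Prop :=
  ∃ τ : ℝ, 0 < τ ∧ ∀ B : Set E, IsBounded B → IsCompact (closure (φ.toFun τ '' B))

/-- Hypothesis (S): a smoothing estimate from `H` to `E`. -/
def IsSmoothing (φ : Semiflow E) (ι : E →L[ℝ] H) : Prop :=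
  ∃ τ C : ℝ, 0 ≤ τ ∧ 0 < C ∧
    ∀ v₁ v₂ : E, ‖φ.toFun τ v₁ - φ.toFun τ v₂‖ ≤ C * ‖ι v₁ - ι v₂‖

/-- An amenable trajectory: a complete trajectory with
`∫_{-∞}^0 e^{2νs} |v(s)|²_H ds < ∞`. -/
def IsAmenableTrajectory (φ : Semiflow E) (ι : E →L[ℝ] H) (ν : ℝ) (v : ℝ → E) : Prop :=
  φ.IsCompleteTrajectory v ∧
    IntegrableOn (fun s : ℝ => Real.exp (2 * ν * s) * ‖ι (v s)‖ ^ 2) (Set.Iic (0 : ℝ))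

/-- The amenable set `𝔄`: points through which an amenable trajectory passes. -/
def amenableSet (φ : Semiflow E) (ι : E →L[ℝ] H) (ν : ℝ) : Set E :=
  {v₀ | ∃ v : ℝ → E, φ.IsAmenableTrajectory ι ν v ∧ v 0 = v₀}

/-- Orbital stability of a set `γ`. -/
def IsOrbitallyStable (φ : Semiflow E) (γ : Set E) : Prop :=
  ∀ ε : ℝ, 0 < ε → ∃ δ : ℝ, 0 < δ ∧
    ∀ v ∈ setNbhd γ δ, ∀ t : ℝ, 0 ≤ t → φ.toFun t v ∈ setNbhd γ ε

/-- Amenable stability: orbital stability with respect to initial data in `𝔄`. -/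
def IsAmenableStable (φ : Semiflow E) (ι : E →L[ℝ] H) (ν : ℝ) (γ : Set E) : Prop :=
  ∀ ε : ℝ, 0 < ε → ∃ δ : ℝ, 0 < δ ∧
    ∀ v ∈ setNbhd γ δ ∩ φ.amenableSet ι ν, ∀ t : ℝ, 0 ≤ t → φ.toFun t v ∈ setNbhd γ ε

/-- Lyapunov stability of a stationary point. -/
def IsLyapunovStable (φ : Semiflow E) (v₀ : E) : Prop :=
  ∀ ε : ℝ, 0 < ε → ∃ δ : ℝ, 0 < δ ∧
    ∀ v : E, ‖v - v₀‖ < δ → ∀ t : ℝ, 0 ≤ t → ‖φ.toFun t v - v₀‖ < ε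

/-- `D` is a `k`-dimensional local unstable set for the stationary point `v₀`:
(U1) `D` is a homeomorphic image of an open `k`-cube; (U2) through every point of `D`
there is a unique complete trajectory, converging to `v₀` as `t → -∞`;
(U3) trajectories through points of `D` near `v₀` stay near `v₀` for `t ≤ 0`. -/
def IsLocalUnstableSet (φ : Semiflow E) (k : ℕ) (v₀ : E) (D : Set E) : Prop :=
  v₀ ∈ D ∧
    Nonempty (↥(Set.pi Set.univ fun _ : Fin k => Set.Ioo (0 : ℝ) 1) ≃ₜ ↥D) ∧
    (∀ w₀ ∈ D, ∃! w : ℝ → E, φ.IsCompleteTrajectory w ∧ w 0 = w₀) ∧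
    (∀ w₀ ∈ D, ∀ w : ℝ → E, φ.IsCompleteTrajectory w → w 0 = w₀ →
      Filter.Tendsto w Filter.atBot (nhds v₀)) ∧
    (∀ ε : ℝ, 0 < ε → ∃ δ : ℝ, 0 < δ ∧ ∀ w₀ ∈ D, ‖w₀ - v₀‖ < δ →
      ∀ w : ℝ → E, φ.IsCompleteTrajectory w → w 0 = w₀ → ∀ t : ℝ, t ≤ 0 → ‖w t - v₀‖ < ε)

/-- An unstable terminal point: a stationary point with a 2-dimensional local unstable set. -/
def IsUnstableTerminal (φ : Semiflow E) (v₀ : E) : Prop :=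
  φ.IsStationary v₀ ∧ ∃ D : Set E, φ.IsLocalUnstableSet 2 v₀ D

/-- A terminal point: a stationary point that is Lyapunov stable or has a
2-dimensional local unstable set. -/
def IsTerminal (φ : Semiflow E) (v₀ : E) : Prop :=
  φ.IsStationary v₀ ∧
    (φ.IsLyapunovStable v₀ ∨ ∃ D : Set E, φ.IsLocalUnstableSet 2 v₀ D)

/-- An attractor: a bounded closed set with an open neighborhood all of whose points have
precompact positive semi-orbits with ω-limit sets inside the set. -/
def IsAttractor (φ : Semiflow E) (A : Set E) : Prop :=
  IsBounded A ∧ IsClosed A ∧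
    ∃ U : Set E, IsOpen U ∧ A ⊆ U ∧
      ∀ v₀ ∈ U, IsCompact (closure (φ.orbit v₀)) ∧ φ.omegaLimit v₀ ⊆ A

/-- `Pi` is the `V`-orthogonal projector onto `Eminus`. -/
def IsVProjector (P : E →L[ℝ] E →L[ℝ] ℝ) (Eminus : Submodule ℝ E) (Pi : E → E) : Prop :=
  ∀ v : E, Pi v ∈ Eminus ∧ ∀ w ∈ Eminus, P w v = P w (Pi v)

/-- The interior region `𝒢_γ ⊆ 𝔄` of a periodic orbit `γ`: the preimage under `Π`
of the bounded connected component of `E⁻ \ Πγ`. -/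
def interiorRegion (φ : Semiflow E) (ι : E →L[ℝ] H) (ν : ℝ) (Eminus : Submodule ℝ E)
    (Pi : E → E) (γ : Set E) : Set E :=
  {a | a ∈ φ.amenableSet ι ν ∧ Pi a ∈ (Eminus : Set E) \ (Pi '' γ) ∧
    IsBounded (connectedComponentIn ((Eminus : Set E) \ (Pi '' γ)) (Pi a))}

/-- The partial order `γ₁ ⩽ γ₂` on periodic orbits: `𝒢_{γ₁} ⊆ 𝒢_{γ₂}`. -/
def orbitLE (φ : Semiflow E) (ι : E →L[ℝ] H) (ν : ℝ) (Eminus : Submodule ℝ E)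
    (Pi : E → E) (γ₁ γ₂ : Set E) : Prop :=
  φ.interiorRegion ι ν Eminus Pi γ₁ ⊆ φ.interiorRegion ι ν Eminus Pi γ₂

/-- External stability of a periodic orbit `γ`. -/
def IsExternallyStable (φ : Semiflow E) (ι : E →L[ℝ] H) (ν : ℝ) (Eminus : Submodule ℝ E)
    (Pi : E → E) (γ : Set E) : Prop :=
  (∃ g : ℕ → Set E, (∀ k, φ.IsPeriodicOrbit (g k)) ∧ (∀ k, g k ≠ γ) ∧
      (∀ k, φ.orbitLE ι ν Eminus Pi γ (g k)) ∧
      Filter.Tendsto (fun k => Metric.hausdorffDist (g k) γ) Filter.atTop (nhds 0)) ∨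
    (∃ v₀ ∈ φ.amenableSet ι ν \ closure (φ.interiorRegion ι ν Eminus Pi γ),
      φ.omegaLimit v₀ = γ)

/-- Internal stability of a periodic orbit `γ`. -/
def IsInternallyStable (φ : Semiflow E) (ι : E →L[ℝ] H) (ν : ℝ) (Eminus : Submodule ℝ E)
    (Pi : E → E) (γ : Set E) : Prop :=
  (∃ g : ℕ → Set E, (∀ k, φ.IsPeriodicOrbit (g k)) ∧ (∀ k, g k ≠ γ) ∧
      (∀ k, φ.orbitLE ι ν Eminus Pi (g k) γ) ∧
      Filter.Tendsto (fun k => Metric.hausdorffDist (g k) γ) Filter.atTop (nhds 0)) ∨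
    (∃ v₀ ∈ φ.interiorRegion ι ν Eminus Pi γ, φ.omegaLimit v₀ = γ)

end Semiflow

namespace Semiflow

section AmenableAux

variable {E : Type*} [NormedAddCommGroup E] [NormedSpace ℝ E]
variable {H : Type*} [NormedAddCommGroup H] [InnerProductSpace ℝ H]

/-- Time shifts of amenable trajectories are amenable. -/
theorem IsAmenableTrajectory.shift {φ : Semiflow E} {ι : E →L[ℝ] H} {ν : ℝ} {v : ℝ → E}
    (h : φ.IsAmenableTrajectory ι ν v) (a : ℝ) :
    φ.IsAmenableTrajectory ι ν (fun s => v (s + a)) := by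
  obtain ⟨⟨hc, ht⟩, hi⟩ := h
  refine ⟨⟨by fun_prop, fun t h0 s => by
    simp only [add_assoc]; exact ht t h0 _⟩, ?_⟩
  have hcont : Continuous (fun s : ℝ => Real.exp (2 * ν * s) * ‖ι (v s)‖ ^ 2) := by fun_prop
  have h1 : IntegrableOn (fun s : ℝ => Real.exp (2 * ν * s) * ‖ι (v s)‖ ^ 2) (Set.Iic a) := by
    have h2 : IntegrableOn (fun s : ℝ => Real.exp (2 * ν * s) * ‖ι (v s)‖ ^ 2)
        (Set.Icc 0 a) := hcont.continuousOn.integrableOn_Icc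
    refine (hi.union h2).mono_set ?_
    intro x hx
    rcases le_total x 0 with h | h
    · exact Or.inl h
    · exact Or.inr ⟨h, hx⟩
  have h3 : IntegrableOn (fun s : ℝ => Real.exp (2 * ν * (s + a)) * ‖ι (v (s + a))‖ ^ 2)
      (Set.Iic 0) := by
    have := (measurePreserving_add_right volume a).integrableOn_comp_preimage
      (MeasurableEquiv.addRight a).measurableEmbedding
      (f := fun s : ℝ => Real.exp (2 * ν * s) * ‖ι (v s)‖ ^ 2) (s := Set.Iic a)
    have h4 := this.2 h1
    simpa [Function.comp_def] using h4
  have h5 := h3.const_mul (Real.exp (-(2 * ν * a)))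
  refine h5.congr (Eventually.of_forall fun s => ?_)
  simp only
  rw [← mul_assoc, ← Real.exp_add]
  congr 2
  ring

/-- The integrated squeezing estimate along differences of amenable trajectories. -/
theorem amenable_squeeze (φ : Semiflow E) (ι : E →L[ℝ] H) (P : E →L[ℝ] E →L[ℝ] ℝ)
    (δ τV ν : ℝ) (hH3 : φ.IsH3 ι P δ τV ν) (hS : φ.IsSmoothing ι)
    (v₁ v₂ : ℝ → E) (h₁ : φ.IsAmenableTrajectory ι ν v₁) (h₂ : φ.IsAmenableTrajectory ι ν v₂)
    (L : ℝ) (hL : L ≤ 0) :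
    δ * ∫ s in L..0, Real.exp (2 * ν * s) * ‖ι (v₁ s) - ι (v₂ s)‖ ^ 2 ≤
      - P (v₁ 0 - v₂ 0) (v₁ 0 - v₂ 0) := by
  obtain ⟨hδ, hτV, hν, h3⟩ := hH3
  obtain ⟨τ, C, hτ, hC, hsm⟩ := hS
  obtain ⟨⟨hc1, ht1⟩, hi1⟩ := h₁
  obtain ⟨⟨hc2, ht2⟩, hi2⟩ := h₂
  set g : ℝ → ℝ := fun s => Real.exp (2 * ν * s) * ‖ι (v₁ s) - ι (v₂ s)‖ ^ 2 with hg
  have hgc : Continuous g := by fun_prop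
  have hg0 : ∀ s, 0 ≤ g s := fun s => by simp only [hg]; positivity
  have hgi : IntegrableOn g (Set.Iic 0) := by
    refine Integrable.mono' ((hi1.add hi2).const_mul 2) hgc.aestronglyMeasurable
      (Eventually.of_forall fun s => ?_)
    rw [Real.norm_of_nonneg (hg0 s)]
    simp only [hg, Pi.add_apply]
    have e := norm_sub_le (ι (v₁ s)) (ι (v₂ s))
    have e2 : ‖ι (v₁ s) - ι (v₂ s)‖ ^ 2 ≤ 2 * (‖ι (v₁ s)‖ ^ 2 + ‖ι (v₂ s)‖ ^ 2) := by
      nlinarith [sq_nonneg (‖ι (v₁ s)‖ - ‖ι (v₂ s)‖), norm_nonneg (ι (v₁ s) - ι (v₂ s))]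
    have := mul_le_mul_of_nonneg_left e2 (Real.exp_pos (2 * ν * s)).le
    linarith
  -- arbitrarily negative times with small `g`
  have hsmall : ∀ ε > 0, ∀ M ≤ (0:ℝ), ∃ s ≤ M, g s ≤ ε := by
    intro ε hε M hM
    by_contra! hcon
    have hc : IntegrableOn (fun _ : ℝ => ε) (Set.Iic M) := by
      refine Integrable.mono' (hgi.mono_set (Set.Iic_subset_Iic.2 hM))
        aestronglyMeasurable_const ?_
      refine (ae_restrict_iff' measurableSet_Iic).2 (Eventually.of_forall fun s hs => ?_)
      rw [Real.norm_of_nonneg hε.le]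
      exact (hcon s hs).le
    rw [integrableOn_const_iff] at hc
    simp [hε.ne'] at hc
  -- the basic inequality
  have hbasic : ∀ l, l ≤ L → l ≤ -τV → P (v₁ 0 - v₂ 0) (v₁ 0 - v₂ 0) -
      Real.exp (2 * ν * l) * P (v₁ l - v₂ l) (v₁ l - v₂ l) ≤ -δ * ∫ s in L..0, g s := by
    intro l hlL hlτ
    have key := h3 (v₁ l) (v₂ l) 0 (-l) le_rfl (by linarith) (by linarith)
    have hint : ∫ s in (0:ℝ)..(-l), Real.exp (2 * ν * s) *
        ‖ι (φ.toFun s (v₁ l)) - ι (φ.toFun s (v₂ l))‖ ^ 2 =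
        Real.exp (-(2 * ν * l)) * ∫ s in l..0, g s := by
      have e1 : ∫ s in l..0, g s = ∫ s in (0:ℝ)..(-l), g (s + l) := by
        rw [intervalIntegral.integral_comp_add_right (fun x => g x)]
        simp
      rw [e1, ← intervalIntegral.integral_const_mul]
      refine intervalIntegral.integral_congr fun s hs => ?_
      rw [Set.uIcc_of_le (by linarith)] at hs
      simp only [hg]
      rw [ht1 s hs.1 l, ht2 s hs.1 l, ← mul_assoc, ← Real.exp_add]
      congr 2
      ring
    rw [hint, ← ht1 (-l) (by linarith) l, ← ht2 (-l) (by linarith) l, φ.map_zero', φ.map_zero']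
      at key
    simp only [neg_add_cancel, mul_zero, Real.exp_zero, one_mul] at key
    have hmono : ∫ s in L..0, g s ≤ ∫ s in l..0, g s := by
      rw [← intervalIntegral.integral_add_adjacent_intervals
        (hgc.intervalIntegrable l L) (hgc.intervalIntegrable L 0)]
      have := intervalIntegral.integral_nonneg hlL (fun s _ => hg0 s) (μ := volume)
      linarith
    have hm := mul_le_mul_of_nonneg_left key (Real.exp_pos (2 * ν * l)).le
    have hA : Real.exp (2 * ν * l) * Real.exp (2 * ν * -l) = 1 := by
      rw [← Real.exp_add]; simp
    have hB : Real.exp (2 * ν * l) * Real.exp (-(2 * ν * l)) = 1 := by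
      rw [← Real.exp_add]; simp
    have hl : Real.exp (2 * ν * l) * (-δ * (Real.exp (-(2 * ν * l)) * ∫ s in l..0, g s))
        = -δ * ∫ s in l..0, g s := by
      linear_combination (-δ * ∫ s in l..0, g s) * hB
    rw [hl, mul_sub, ← mul_assoc, hA, one_mul] at hm
    have := mul_le_mul_of_nonneg_left hmono hδ.le
    linarith
  refine le_of_forall_pos_le_add fun ε hε => ?_
  set K : ℝ := Real.exp (2 * ν * τ) * (‖P‖ * C ^ 2) with hK
  have hK0 : 0 ≤ K := by positivity
  obtain ⟨s, hs, hgs⟩ := hsmall (ε / (K + 1)) (by positivity) (min L (-τV) - τ)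
    (by have := min_le_left L (-τV); linarith)
  have hle1 := min_le_left L (-τV)
  have hle2 := min_le_right L (-τV)
  have hb := hbasic (τ + s) (by linarith) (by linarith)
  have hP : P (v₁ (τ + s) - v₂ (τ + s)) (v₁ (τ + s) - v₂ (τ + s)) ≤
      ‖P‖ * C ^ 2 * ‖ι (v₁ s) - ι (v₂ s)‖ ^ 2 := by
    have e1 := P.le_opNorm₂ (v₁ (τ + s) - v₂ (τ + s)) (v₁ (τ + s) - v₂ (τ + s))
    have e2 := hsm (v₁ s) (v₂ s)
    rw [← ht1 τ hτ s, ← ht2 τ hτ s] at e2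
    have e3 : ‖v₁ (τ + s) - v₂ (τ + s)‖ * ‖v₁ (τ + s) - v₂ (τ + s)‖ ≤
        (C * ‖ι (v₁ s) - ι (v₂ s)‖) * (C * ‖ι (v₁ s) - ι (v₂ s)‖) :=
      mul_le_mul e2 e2 (norm_nonneg _) (by positivity)
    have e4 := mul_le_mul_of_nonneg_left e3 (norm_nonneg P)
    have e5 := (le_abs_self _).trans e1
    nlinarith [e4, e5]
  have hE : Real.exp (2 * ν * (τ + s)) * P (v₁ (τ + s) - v₂ (τ + s)) (v₁ (τ + s) - v₂ (τ + s))
      ≤ K * g s := by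
    have := mul_le_mul_of_nonneg_left hP (Real.exp_pos (2 * ν * (τ + s))).le
    refine this.trans (le_of_eq ?_)
    rw [mul_add, Real.exp_add]
    simp only [hK, hg]
    ring
  have hF : K * g s ≤ ε := by
    calc K * g s ≤ K * (ε / (K + 1)) := mul_le_mul_of_nonneg_left hgs hK0
      _ = ε * (K / (K + 1)) := by ring
      _ ≤ ε * 1 := by
        refine mul_le_mul_of_nonneg_left ?_ hε.le
        rw [div_le_one (by positivity)]; linarith
      _ = ε := mul_one _
  linarith

/-- Quantitative backward estimate for differences of amenable trajectories. -/
theorem amenable_backward (φ : Semiflow E) (ι : E →L[ℝ] H) (P : E →L[ℝ] E →L[ℝ] ℝ)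
    (δ τV ν : ℝ) (hH3 : φ.IsH3 ι P δ τV ν) (hS : φ.IsSmoothing ι) (T : ℝ) (hT : 0 ≤ T) :
    ∃ K : ℝ, ∀ v₁ v₂ : ℝ → E, φ.IsAmenableTrajectory ι ν v₁ → φ.IsAmenableTrajectory ι ν v₂ →
      ∃ σ ∈ Set.Icc (-T - 1) (-T), ‖v₁ σ - v₂ σ‖ ^ 2 ≤ K * ‖v₁ 0 - v₂ 0‖ ^ 2 := by
  have hS' := hS
  obtain ⟨τ, C, hτ, hC, hsm⟩ := hS
  have hδ := hH3.1
  have hν := hH3.2.2.1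
  refine ⟨C ^ 2 * (Real.exp (2 * ν * (T + τ + 1)) * (‖P‖ / δ)), fun v₁ v₂ h₁ h₂ => ?_⟩
  have hsq := amenable_squeeze φ ι P δ τV ν hH3 hS' v₁ v₂ h₁ h₂ (-T - τ - 1) (by linarith)
  obtain ⟨⟨hc1, ht1⟩, -⟩ := h₁
  obtain ⟨⟨hc2, ht2⟩, -⟩ := h₂
  set g : ℝ → ℝ := fun s => Real.exp (2 * ν * s) * ‖ι (v₁ s) - ι (v₂ s)‖ ^ 2 with hg
  have hgc : Continuous g := by fun_prop
  have hg0 : ∀ s, 0 ≤ g s := fun s => by simp only [hg]; positivity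
  have hex : ∃ s ∈ Set.Icc (-T - τ - 1) (-T - τ), g s ≤ ∫ s in (-T - τ - 1)..0, g s := by
    obtain ⟨s, hs, hmin⟩ := isCompact_Icc.exists_isMinOn
      (Set.nonempty_Icc.2 (by linarith : -T - τ - 1 ≤ -T - τ)) hgc.continuousOn
    refine ⟨s, hs, ?_⟩
    rw [← intervalIntegral.integral_add_adjacent_intervals
        (hgc.intervalIntegrable (-T - τ - 1) (-T - τ)) (hgc.intervalIntegrable (-T - τ) 0)]
    have e1 := intervalIntegral.integral_nonneg (by linarith : -T - τ ≤ 0) (fun s _ => hg0 s)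
      (μ := volume)
    have e2 : ∫ _ in (-T - τ - 1)..(-T - τ), g s ≤ ∫ u in (-T - τ - 1)..(-T - τ), g u :=
      intervalIntegral.integral_mono_on (by linarith) (by simp)
        (hgc.intervalIntegrable _ _) (fun u hu => hmin hu)
    rw [intervalIntegral.integral_const] at e2
    have e3 : (-T - τ - (-T - τ - 1)) • g s = g s := by simp
    linarith
  obtain ⟨s, hs, hgs⟩ := hex
  refine ⟨τ + s, ⟨by linarith [hs.1], by linarith [hs.2]⟩, ?_⟩
  have e2 := hsm (v₁ s) (v₂ s)
  rw [← ht1 τ hτ s, ← ht2 τ hτ s] at e2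
  have e3 : ‖v₁ (τ + s) - v₂ (τ + s)‖ ^ 2 ≤ C ^ 2 * ‖ι (v₁ s) - ι (v₂ s)‖ ^ 2 := by
    rw [← mul_pow]
    exact pow_le_pow_left₀ (norm_nonneg _) e2 2
  have e4 : -P (v₁ 0 - v₂ 0) (v₁ 0 - v₂ 0) ≤ ‖P‖ * ‖v₁ 0 - v₂ 0‖ ^ 2 := by
    have := P.le_opNorm₂ (v₁ 0 - v₂ 0) (v₁ 0 - v₂ 0)
    have h' := (neg_le_abs _).trans this
    rw [sq, ← mul_assoc]; exact h'
  have e5 : g s ≤ ‖P‖ / δ * ‖v₁ 0 - v₂ 0‖ ^ 2 := by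
    rw [div_mul_eq_mul_div, le_div_iff₀ hδ, mul_comm]
    have := mul_le_mul_of_nonneg_left hgs hδ.le
    linarith
  have e6 : ‖ι (v₁ s) - ι (v₂ s)‖ ^ 2 ≤ Real.exp (2 * ν * (T + τ + 1)) * g s := by
    simp only [hg]
    rw [← mul_assoc, ← Real.exp_add]
    refine le_mul_of_one_le_left (by positivity) (Real.one_le_exp ?_)
    have : 0 ≤ ν * (T + τ + 1 + s) := mul_nonneg hν.le (by linarith [hs.1])
    nlinarith
  calc _ ≤ C ^ 2 * ‖ι (v₁ s) - ι (v₂ s)‖ ^ 2 := e3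
    _ ≤ C ^ 2 * (Real.exp (2 * ν * (T + τ + 1)) * (‖P‖ / δ * ‖v₁ 0 - v₂ 0‖ ^ 2)) := by gcongr; exact e6.trans (by gcongr)
    _ = _ := by ring

theorem IsCompleteTrajectory.eq_toFun {φ : Semiflow E} {v : ℝ → E}
    (h : φ.IsCompleteTrajectory v) {s t : ℝ} (hst : s ≤ t) : v t = φ.toFun (t - s) (v s) := by
  rw [← h.2 (t - s) (by linarith) s, sub_add_cancel]

theorem amenable_unique (φ : Semiflow E) (ι : E →L[ℝ] H) (P : E →L[ℝ] E →L[ℝ] ℝ)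
    (δ τV ν : ℝ) (hH3 : φ.IsH3 ι P δ τV ν) (hS : φ.IsSmoothing ι) (v₁ v₂ : ℝ → E)
    (h₁ : φ.IsAmenableTrajectory ι ν v₁) (h₂ : φ.IsAmenableTrajectory ι ν v₂)
    (h0 : v₁ 0 = v₂ 0) (t : ℝ) : v₁ t = v₂ t := by
  obtain ⟨K, hK⟩ := amenable_backward φ ι P δ τV ν hH3 hS |t| (abs_nonneg t)
  obtain ⟨σ, hσ, hle⟩ := hK v₁ v₂ h₁ h₂
  rw [h0, sub_self, norm_zero] at hle
  have h2 : ‖v₁ σ - v₂ σ‖ = 0 := by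
    have : ‖v₁ σ - v₂ σ‖ ^ 2 ≤ 0 := by simpa using hle
    exact pow_eq_zero_iff (two_ne_zero) |>.1 (le_antisymm this (by positivity))
  have h3 : v₁ σ = v₂ σ := sub_eq_zero.1 (norm_eq_zero.1 h2)
  have hst : σ ≤ t := hσ.2.trans (neg_abs_le t)
  rw [h₁.1.eq_toFun hst, h₂.1.eq_toFun hst, h3]

theorem amenable_seq_cont (φ : Semiflow E) (ι : E →L[ℝ] H) (P : E →L[ℝ] E →L[ℝ] ℝ)
    (δ τV ν : ℝ) (hH3 : φ.IsH3 ι P δ τV ν) (hS : φ.IsSmoothing ι) (v : ℝ → E)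
    (hv : φ.IsAmenableTrajectory ι ν v) (w : ℕ → ℝ → E)
    (hw : ∀ k, φ.IsAmenableTrajectory ι ν (w k))
    (h0 : Tendsto (fun k => w k 0) atTop (𝓝 (v 0))) (T : ℝ) (hT : 0 ≤ T) :
    Tendsto (fun k => w k (-T)) atTop (𝓝 (v (-T))) := by
  obtain ⟨K, hK⟩ := amenable_backward φ ι P δ τV ν hH3 hS T hT
  choose σ hσ hle using fun k => hK (w k) v (hw k) hv
  have hd : Tendsto (fun k => w k (σ k) - v (σ k)) atTop (𝓝 0) := by
    rw [tendsto_zero_iff_norm_tendsto_zero]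
    have h1 : Tendsto (fun k => K * ‖w k 0 - v 0‖ ^ 2) atTop (𝓝 0) := by
      have := (((tendsto_sub_nhds_zero_iff.2 h0).norm).pow 2).const_mul K
      simpa using this
    have h2 : Tendsto (fun k => ‖w k (σ k) - v (σ k)‖ ^ 2) atTop (𝓝 0) :=
      squeeze_zero (fun k => by positivity) hle h1
    have h3 := h2.sqrt
    simpa [Real.sqrt_sq] using h3
  refine tendsto_of_subseq_tendsto fun ns hns => ?_
  obtain ⟨σ', hσ', ms, hms, hlim⟩ := isCompact_Icc.tendsto_subseq (fun k => hσ (ns k))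
  refine ⟨ms, ?_⟩
  have hnm : Tendsto (fun k => ns (ms k)) atTop atTop := hns.comp hms.tendsto_atTop
  have h1 : Tendsto (fun k => v (σ (ns (ms k)))) atTop (𝓝 (v σ')) :=
    (hv.1.1.tendsto σ').comp hlim
  have h2 : Tendsto (fun k => w (ns (ms k)) (σ (ns (ms k)))) atTop (𝓝 (v σ')) := by
    have := (hd.comp hnm).add h1
    simpa [Function.comp_def] using this
  have h3 : Tendsto (fun k => (-T - σ (ns (ms k)), w (ns (ms k)) (σ (ns (ms k))))) atTop
      (𝓝 (-T - σ', v σ')) := (hlim.const_sub (-T)).prodMk_nhds h2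
  have h4 : Tendsto (fun k => (-T - σ (ns (ms k)), w (ns (ms k)) (σ (ns (ms k))))) atTop
      (𝓝[Set.Ici (0 : ℝ) ×ˢ Set.univ] (-T - σ', v σ')) :=
    tendsto_nhdsWithin_iff.2 ⟨h3, Eventually.of_forall fun k =>
      ⟨sub_nonneg.2 (hσ _).2, trivial⟩⟩
  have h5 := (φ.continuousOn' (-T - σ', v σ') ⟨sub_nonneg.2 hσ'.2, trivial⟩).tendsto.comp h4
  simp only [Function.comp_def] at h5
  rw [hv.1.eq_toFun hσ'.2]
  refine h5.congr fun k => ?_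
  exact ((hw _).1.eq_toFun (hσ _).2).symm

end AmenableAux

end Semiflow

/-- Corollary 4 ((A1),(A2)): the amenable set `𝔄` is invariant, each `φ^t` is a
homeomorphism of `𝔄` onto itself, and the restriction of `φ` to `𝔄` extends to a flow. -/
theorem amenableSet_invariant_flow
    {E : Type*} [NormedAddCommGroup E] [NormedSpace ℝ E]
    {H : Type*} [NormedAddCommGroup H] [InnerProductSpace ℝ H]
    (ι : E →L[ℝ] H) (hι : Function.Injective ι)
    (φ : Semiflow E)
    (P : E →L[ℝ] E →L[ℝ] ℝ) (Eplus Eminus : Submodule ℝ E)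
    (hH1 : Semiflow.IsH1 P Eplus Eminus)
    (j : ℕ) [FiniteDimensional ℝ ↥Eminus] (hH2 : Module.finrank ℝ ↥Eminus = j)
    (δ τV ν : ℝ) (hH3 : φ.IsH3 ι P δ τV ν)
    (hCOM : φ.IsCOM) (hS : φ.IsSmoothing ι)
    (hne : (φ.amenableSet ι ν).Nonempty) :
    (∀ t : ℝ, 0 ≤ t → φ.toFun t '' φ.amenableSet ι ν = φ.amenableSet ι ν) ∧
    (∀ t : ℝ, 0 ≤ t → ∃ h : ↥(φ.amenableSet ι ν) ≃ₜ ↥(φ.amenableSet ι ν),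
      ∀ x : ↥(φ.amenableSet ι ν), (↑(h x) : E) = φ.toFun t (↑x : E)) ∧
    (∃ ξ : ℝ → ↥(φ.amenableSet ι ν) → ↥(φ.amenableSet ι ν),
      Continuous (fun p : ℝ × ↥(φ.amenableSet ι ν) => ξ p.1 p.2) ∧
      (∀ x, ξ 0 x = x) ∧ (∀ t s : ℝ, ∀ x, ξ (t + s) x = ξ t (ξ s x)) ∧
      (∀ t : ℝ, 0 ≤ t → ∀ x : ↥(φ.amenableSet ι ν),
        (↑(ξ t x) : E) = φ.toFun t (↑x : E))) := by
  set A := φ.amenableSet ι ν with hA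
  choose c hc hc0 using fun x : ↥A => x.2
  have huniq := Semiflow.amenable_unique φ ι P δ τV ν hH3 hS
  have hmem : ∀ (v : ℝ → E), φ.IsAmenableTrajectory ι ν v → ∀ t, v t ∈ A := fun v hv t =>
    ⟨_, hv.shift t, by simp⟩
  let ξ : ℝ → ↥A → ↥A := fun t x => ⟨c x t, hmem _ (hc x) t⟩
  have hξ0 : ∀ x, ξ 0 x = x := fun x => Subtype.ext (hc0 x)
  have hξadd : ∀ t s : ℝ, ∀ x, ξ (t + s) x = ξ t (ξ s x) := by
    intro t s x
    refine Subtype.ext ?_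
    exact huniq _ _ ((hc x).shift s) (hc (ξ s x))
      (by simp only [zero_add]; exact (hc0 (ξ s x)).symm) t
  have hξφ : ∀ t : ℝ, 0 ≤ t → ∀ x : ↥A, (↑(ξ t x) : E) = φ.toFun t (↑x : E) := by
    intro t ht x
    have := (hc x).1.2 t ht 0
    rw [add_zero, hc0 x] at this
    exact this
  have hback : ∀ T : ℝ, 0 ≤ T → Continuous (fun x : ↥A => c x (-T)) := by
    intro T hT
    refine continuous_iff_continuousAt.2 fun a => ?_
    refine tendsto_of_seq_tendsto fun x hx => ?_
    refine Semiflow.amenable_seq_cont φ ι P δ τV ν hH3 hS (c a) (hc a) (fun k => c (x k))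
      (fun k => hc (x k)) ?_ T hT
    simp only [hc0]
    exact (continuous_subtype_val.tendsto a).comp hx
  have hcont : Continuous (fun p : ℝ × ↥A => ξ p.1 p.2) := by
    refine Continuous.subtype_mk ?_ _
    refine continuous_iff_continuousAt.2 fun ⟨t, a⟩ => ?_
    set T : ℝ := |t| + 1 with hT
    have hT0 : 0 ≤ T := by positivity
    have htT : -T < t := by have := neg_abs_le t; linarith
    have hev : ∀ᶠ p : ℝ × ↥A in 𝓝 (t, a), -T < p.1 :=
      continuous_fst.continuousAt.eventually (lt_mem_nhds htT)
    have hmap : Tendsto (fun p : ℝ × ↥A => (p.1 - -T, c p.2 (-T))) (𝓝 (t, a))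
        (𝓝[Set.Ici (0 : ℝ) ×ˢ Set.univ] (t - -T, c a (-T))) := by
      refine tendsto_nhdsWithin_iff.2 ⟨?_, ?_⟩
      · have : Continuous (fun p : ℝ × ↥A => (p.1 - -T, c p.2 (-T))) :=
          (by fun_prop : Continuous (fun p : ℝ × ↥A => p.1 - -T)).prodMk
            ((hback T hT0).comp continuous_snd)
        exact this.tendsto (t, a)
      · filter_upwards [hev] with p hp
        exact ⟨sub_nonneg.2 hp.le, trivial⟩
    have h5 := (φ.continuousOn' (t - -T, c a (-T)) ⟨sub_nonneg.2 htT.le, trivial⟩).tendsto.comp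
      hmap
    unfold ContinuousAt
    simp only [(hc a).1.eq_toFun htT.le]
    refine h5.congr' ?_
    filter_upwards [hev] with p hp
    exact ((hc p.2).1.eq_toFun hp.le).symm
  refine ⟨?_, ?_, ξ, hcont, hξ0, hξadd, hξφ⟩
  · intro t ht
    ext y
    constructor
    · rintro ⟨x, hx, rfl⟩
      rw [← hξφ t ht ⟨x, hx⟩]
      exact (ξ t ⟨x, hx⟩).2
    · intro hy
      refine ⟨ξ (-t) ⟨y, hy⟩, (ξ (-t) ⟨y, hy⟩).2, ?_⟩
      rw [← hξφ t ht, ← hξadd, add_neg_cancel, hξ0]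
  · intro t ht
    refine ⟨⟨⟨ξ t, ξ (-t), fun x => ?_, fun x => ?_⟩, ?_, ?_⟩, fun x => hξφ t ht x⟩
    · rw [← hξadd, neg_add_cancel, hξ0]
    · rw [← hξadd, add_neg_cancel, hξ0]
    · exact hcont.comp (Continuous.prodMk_right t)
    · exact hcont.comp (Continuous.prodMk_right (-t))
end

section
/- Let φ be a semiflow on E satisfying (H1), (H2), (H3), (COM) and (S) with nonempty amenable set 𝔄, let Π : E → E⁻ be the V-orthogonal projector and Φ : E⁻ → 𝔄 the inverse of the homeomorphism Π|_𝔄. Then for every v₀ ∈ E whose positive semi-orbit ⋃_{t≥0}{φ^t(v₀)} is precompact in E, one has ‖φ^t(v₀) − Φ(Π φ^t(v₀))‖_E → 0 as t → +∞. -/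
open Set Filter Topology MeasureTheory Bornology

section Helpers

variable {E : Type*} [NormedAddCommGroup E] [NormedSpace ℝ E]
variable {H : Type*} [NormedAddCommGroup H] [InnerProductSpace ℝ H]

/-- If `x` is `V`-orthogonal to `E⁻` modulo `z ∈ E⁻`, then `V z ≤ V x`. -/
theorem aux_V_le (P : E →L[ℝ] E →L[ℝ] ℝ) (Eplus Eminus : Submodule ℝ E)
    (hH1 : Semiflow.IsH1 P Eplus Eminus) (x z : E) (hz : z ∈ Eminus)
    (h : ∀ u ∈ Eminus, P u x = P u z) : P z z ≤ P x x := by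
  obtain ⟨hsym, -, -, hcompl, hpos, hneg⟩ := hH1
  have hmem : x - z ∈ Eplus ⊔ Eminus := by rw [hcompl.sup_eq_top]; trivial
  obtain ⟨p, hp, m, hm, hpm⟩ := Submodule.mem_sup.1 hmem
  have hp0 : 0 ≤ P p p := by
    by_cases h0 : p = 0
    · simp [h0]
    · exact (hpos p hp h0).le
  have hm0 : P m m ≤ 0 := by
    by_cases h0 : m = 0
    · simp [h0]
    · exact (hneg m hm h0).le
  have hx : x = p + m + z := by rw [hpm]; abel
  have h1 := h m hm
  have h2 := h z hz
  rw [hx] at h1 h2 ⊢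
  have e1 := hsym m p
  have e2 := hsym z p
  have e3 := hsym z m
  simp only [map_add, ContinuousLinearMap.add_apply] at h1 h2 ⊢
  linarith

theorem aux_neg_def (P : E →L[ℝ] E →L[ℝ] ℝ) (Eminus : Submodule ℝ E)
    [FiniteDimensional ℝ ↥Eminus] (hneg : ∀ v ∈ Eminus, v ≠ 0 → P v v < 0) :
    ∃ c : ℝ, 0 < c ∧ ∀ z ∈ Eminus, c * ‖z‖ ^ 2 ≤ - P z z := by
  have hcpt : IsCompact (Metric.sphere (0 : Eminus) 1) := isCompact_sphere 0 1
  have hcont : Continuous (fun z : Eminus => - P (z : E) (z : E)) := by fun_prop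
  rcases (Metric.sphere (0 : Eminus) 1).eq_empty_or_nonempty with he | hne
  · refine ⟨1, one_pos, fun z hz => ?_⟩
    by_cases h0 : z = 0
    · simp [h0]
    · exfalso
      have hn : ‖z‖ ≠ 0 := norm_ne_zero_iff.2 h0
      have : (‖z‖⁻¹ • (⟨z, hz⟩ : Eminus)) ∈ Metric.sphere (0 : Eminus) 1 := by
        simp [norm_smul, hn]
      rw [he] at this
      exact this
  · obtain ⟨y, hy, hmin⟩ := hcpt.exists_isMinOn hne hcont.continuousOn
    have hy0 : (y : E) ≠ 0 := by
      intro h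
      have : ‖(y : E)‖ = 1 := by simpa using hy
      rw [h] at this
      simp at this
    refine ⟨- P y y, by linarith [hneg y y.2 hy0], fun z hz => ?_⟩
    by_cases h0 : z = 0
    · simp [h0]
    · have hn : ‖z‖ ≠ 0 := norm_ne_zero_iff.2 h0
      have hmem : (‖z‖⁻¹ • (⟨z, hz⟩ : Eminus)) ∈ Metric.sphere (0 : Eminus) 1 := by
        simp [norm_smul, hn]
      have := hmin hmem
      simp only [mem_setOf_eq, Submodule.coe_smul, map_smul, ContinuousLinearMap.smul_apply,
        smul_eq_mul] at this
      have h2 : 0 < ‖z‖ ^ 2 := by positivity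
      calc - P y y * ‖z‖ ^ 2 ≤ -(‖z‖⁻¹ * (‖z‖⁻¹ * P z z)) * ‖z‖ ^ 2 :=
            mul_le_mul_of_nonneg_right this h2.le
        _ = - P z z := by field_simp

/-- The projector is Lipschitz-like and so is `V` of it. -/
theorem aux_bound (P : E →L[ℝ] E →L[ℝ] ℝ) (Eminus : Submodule ℝ E)
    [FiniteDimensional ℝ ↥Eminus] (hneg : ∀ v ∈ Eminus, v ≠ 0 → P v v < 0) :
    ∃ c : ℝ, 0 < c ∧ ∀ z ∈ Eminus, ∀ y : E, (∀ u ∈ Eminus, P u y = P u z) →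
      - P z z ≤ c * ‖y‖ ^ 2 := by
  obtain ⟨c, hc, h⟩ := aux_neg_def P Eminus hneg
  refine ⟨(‖P‖ ^ 2 + 1) / c, by positivity, fun z hz y hy => ?_⟩
  have h1 := h z hz
  have h2 : - P z z ≤ ‖P‖ * ‖z‖ * ‖y‖ := by
    rw [← hy z hz]
    have := P.le_opNorm₂ z y
    rw [Real.norm_eq_abs] at this
    linarith [neg_abs_le (P z y)]
  have h3 : c * ‖z‖ ≤ ‖P‖ * ‖y‖ := by
    by_cases h0 : ‖z‖ = 0
    · rw [h0]; simp; positivity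
    · have hp : 0 < ‖z‖ := lt_of_le_of_ne (norm_nonneg z) (Ne.symm h0)
      nlinarith
  have h4 : ‖P‖ * ‖z‖ * ‖y‖ * c ≤ (‖P‖ * ‖y‖) * (‖P‖ * ‖y‖) := by
    have : 0 ≤ ‖P‖ * ‖y‖ := by positivity
    nlinarith
  rw [div_mul_eq_mul_div, le_div_iff₀ hc]
  nlinarith [sq_nonneg ‖y‖]

theorem aux_small (g : ℝ → ℝ) (hg : IntegrableOn g (Iic 0)) (η M : ℝ) (hη : 0 < η) :
    ∃ l ≤ M, g l < η := by
  by_contra hcon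
  push Not at hcon
  have h1 : IntegrableOn g (Iic (min M 0)) := hg.mono_set (Iic_subset_Iic.2 (min_le_right _ _))
  have h2 : IntegrableOn (fun _ : ℝ => η) (Iic (min M 0)) := by
    refine Integrable.mono' h1 (by fun_prop) ?_
    refine (ae_restrict_iff' measurableSet_Iic).2 (Eventually.of_forall fun x hx => ?_)
    rw [Real.norm_of_nonneg hη.le]
    exact hcon x (le_trans hx (min_le_left _ _))
  rw [integrableOn_const_iff] at h2
  simp [hη.ne'] at h2

/-- Key estimate for two amenable trajectories. -/
theorem aux_key (ι : E →L[ℝ] H) (φ : Semiflow E) (P : E →L[ℝ] E →L[ℝ] ℝ)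
    (δ τV ν : ℝ) (hH3 : φ.IsH3 ι P δ τV ν) (τ C : ℝ) (hτ : 0 ≤ τ) (hC : 0 < C)
    (hS : ∀ v₁ v₂ : E, ‖φ.toFun τ v₁ - φ.toFun τ v₂‖ ≤ C * ‖ι v₁ - ι v₂‖)
    (v w : ℝ → E) (hv : φ.IsAmenableTrajectory ι ν v) (hw : φ.IsAmenableTrajectory ι ν w) :
    ∃ s ∈ Icc (-2 : ℝ) (-1), ‖v s - w s‖ ^ 2 ≤
      C ^ 2 * Real.exp (2 * ν * (τ + 2)) / δ * (- P (v 0 - w 0) (v 0 - w 0)) := by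
  obtain ⟨hδ, hτV, hν, h3⟩ := hH3
  obtain ⟨⟨hvc, hvt⟩, hvi⟩ := hv
  obtain ⟨⟨hwc, hwt⟩, hwi⟩ := hw
  set g : ℝ → ℝ := fun s => Real.exp (2 * ν * s) * ‖ι (v s) - ι (w s)‖ ^ 2 with hgdef
  have hgc : Continuous g := by fun_prop
  have hg0 : ∀ s, 0 ≤ g s := fun s => by positivity
  have hgi : IntegrableOn g (Iic 0) := by
    refine Integrable.mono' ((hvi.const_mul 2).add (hwi.const_mul 2))
      hgc.aestronglyMeasurable (Eventually.of_forall fun s => ?_)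
    rw [Real.norm_of_nonneg (hg0 s)]
    simp only [Pi.add_apply, hgdef]
    have h1 : ‖ι (v s) - ι (w s)‖ ^ 2 ≤ 2 * ‖ι (v s)‖ ^ 2 + 2 * ‖ι (w s)‖ ^ 2 := by
      have := norm_sub_le (ι (v s)) (ι (w s))
      nlinarith [norm_nonneg (ι (v s) - ι (w s)), sq_nonneg (‖ι (v s)‖ - ‖ι (w s)‖)]
    nlinarith [Real.exp_pos (2 * ν * s)]
  have hE : ∀ s, ‖v (s + τ) - w (s + τ)‖ ^ 2 ≤ C ^ 2 * ‖ι (v s) - ι (w s)‖ ^ 2 := by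
    intro s
    rw [add_comm s τ, hvt τ hτ s, hwt τ hτ s, ← mul_pow]
    exact pow_le_pow_left₀ (norm_nonneg _) (hS _ _) 2
  -- the integral estimate
  have hint : ∀ l ≤ -(τV + τ + 2), P (v 0 - w 0) (v 0 - w 0) +
      δ * ∫ s in (-τ-2)..(-τ-1), g s ≤
      Real.exp (2 * ν * l) * P (v l - w l) (v l - w l) := by
    intro l hl
    have h := h3 (v l) (w l) 0 (-l) le_rfl (by linarith) (by linarith)
    have hφv : ∀ s, 0 ≤ s → φ.toFun s (v l) = v (s + l) := fun s hs => (hvt s hs l).symm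
    have hφw : ∀ s, 0 ≤ s → φ.toFun s (w l) = w (s + l) := fun s hs => (hwt s hs l).symm
    have hl0 : 0 ≤ -l := by linarith
    rw [hφv _ hl0, hφw _ hl0, φ.map_zero', φ.map_zero'] at h
    have hI : (∫ s in (0:ℝ)..(-l), Real.exp (2 * ν * s) *
        ‖ι (φ.toFun s (v l)) - ι (φ.toFun s (w l))‖ ^ 2) =
        Real.exp (2 * ν * (-l)) * ∫ s in l..0, g s := by
      have h1 : (∫ s in (0:ℝ)..(-l), Real.exp (2 * ν * s) *
        ‖ι (φ.toFun s (v l)) - ι (φ.toFun s (w l))‖ ^ 2) =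
          ∫ s in (0:ℝ)..(-l), Real.exp (2 * ν * (-l)) * g (s + l) := by
        refine intervalIntegral.integral_congr fun s hs => ?_
        rw [uIcc_of_le hl0] at hs
        simp only [hgdef]
        rw [hφv s hs.1, hφw s hs.1, ← mul_assoc, ← Real.exp_add]
        congr 2
        ring
      rw [h1, intervalIntegral.integral_const_mul, intervalIntegral.integral_comp_add_right]
      simp
    rw [hI] at h
    have hmono : (∫ s in (-τ-2)..(-τ-1), g s) ≤ ∫ s in l..0, g s :=
      intervalIntegral.integral_mono_interval (by linarith) (by linarith) (by linarith)
        (Eventually.of_forall hg0) (hgc.intervalIntegrable _ _)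
    have hexp : Real.exp (2 * ν * l) * Real.exp (2 * ν * (-l)) = 1 := by
      rw [← Real.exp_add]; simp
    have h' := mul_le_mul_of_nonneg_left h (Real.exp_pos (2 * ν * l)).le
    simp only [neg_add_cancel, mul_zero, Real.exp_zero, one_mul] at h'
    have e1 : Real.exp (2 * ν * l) * (Real.exp (2 * ν * (-l)) * P (v 0 - w 0) (v 0 - w 0) -
        P (v l - w l) (v l - w l)) = P (v 0 - w 0) (v 0 - w 0) -
        Real.exp (2 * ν * l) * P (v l - w l) (v l - w l) := by
      rw [mul_sub, ← mul_assoc, hexp, one_mul]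
    have e2 : Real.exp (2 * ν * l) * (-δ * (Real.exp (2 * ν * (-l)) * ∫ s in l..0, g s)) =
        -δ * ∫ s in l..0, g s := by
      rw [mul_left_comm, ← mul_assoc (Real.exp (2 * ν * l)), hexp, one_mul]
    rw [e1, e2] at h'
    have := mul_le_mul_of_nonneg_left hmono hδ.le
    linarith
  have hint2 : δ * ∫ s in (-τ-2)..(-τ-1), g s ≤ - P (v 0 - w 0) (v 0 - w 0) := by
    refine le_of_forall_pos_le_add fun ε hε => ?_
    set K : ℝ := Real.exp (2 * ν * τ) * (‖P‖ * C ^ 2) + 1 with hK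
    have hKpos : 0 < K := by positivity
    obtain ⟨l, hl, hgl⟩ := aux_small g hgi (ε / K) (-(τV + τ + 2) - τ) (by positivity)
    have h1 := hint (l + τ) (by linarith)
    have h2 : P (v (l + τ) - w (l + τ)) (v (l + τ) - w (l + τ)) ≤
        ‖P‖ * (C ^ 2 * ‖ι (v l) - ι (w l)‖ ^ 2) := by
      have ha := P.le_opNorm₂ (v (l + τ) - w (l + τ)) (v (l + τ) - w (l + τ))
      have hb := mul_le_mul_of_nonneg_left (hE l) (norm_nonneg P)
      have hc := Real.le_norm_self (P (v (l + τ) - w (l + τ)) (v (l + τ) - w (l + τ)))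
      nlinarith
    have h3 : Real.exp (2 * ν * (l + τ)) * P (v (l + τ) - w (l + τ)) (v (l + τ) - w (l + τ)) ≤
        K * g l := by
      calc _ ≤ Real.exp (2 * ν * (l + τ)) * (‖P‖ * (C ^ 2 * ‖ι (v l) - ι (w l)‖ ^ 2)) :=
            mul_le_mul_of_nonneg_left h2 (Real.exp_pos _).le
        _ = (K - 1) * g l := by
            simp only [hgdef, hK]
            rw [mul_add, Real.exp_add]
            ring
        _ ≤ K * g l := by nlinarith [hg0 l]
    have h4 : K * g l ≤ ε := by
      have := (lt_div_iff₀ hKpos).1 hgl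
      linarith
    linarith
  obtain ⟨s, hs, hmin⟩ := (isCompact_Icc (a := -τ-2) (b := -τ-1)).exists_isMinOn
    (nonempty_Icc.2 (by linarith)) hgc.continuousOn
  have hgs : g s ≤ ∫ s in (-τ-2)..(-τ-1), g s := by
    have := intervalIntegral.integral_mono_on (μ := volume) (a := -τ-2) (b := -τ-1) (f := fun _ => g s) (g := g)
      (by linarith) (continuous_const.intervalIntegrable _ _) (hgc.intervalIntegrable _ _) (fun x hx => hmin hx)
    rw [intervalIntegral.integral_const, smul_eq_mul] at this
    linarith
  refine ⟨s + τ, ⟨by linarith [hs.1], by linarith [hs.2]⟩, (hE s).trans ?_⟩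
  have h5 : g s ≤ - P (v 0 - w 0) (v 0 - w 0) / δ := by
    rw [le_div_iff₀ hδ]
    nlinarith
  have h6 : ‖ι (v s) - ι (w s)‖ ^ 2 ≤ Real.exp (2 * ν * (τ + 2)) * g s := by
    simp only [hgdef]
    rw [← mul_assoc, ← Real.exp_add]
    refine le_mul_of_one_le_left (sq_nonneg _) (Real.one_le_exp ?_)
    nlinarith [hs.1]
  calc C ^ 2 * ‖ι (v s) - ι (w s)‖ ^ 2
      ≤ C ^ 2 * (Real.exp (2 * ν * (τ + 2)) * (- P (v 0 - w 0) (v 0 - w 0) / δ)) := by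
        refine mul_le_mul_of_nonneg_left (h6.trans ?_) (sq_nonneg _)
        exact mul_le_mul_of_nonneg_left h5 (Real.exp_pos _).le
    _ = _ := by ring

theorem aux_tendsto (φ : Semiflow E) {α : Type*} {l : Filter α} (t : α → ℝ) (x : α → E)
    (t₀ : ℝ) (x₀ : E) (ht₀ : 0 ≤ t₀) (ht : ∀ᶠ a in l, 0 ≤ t a) (h1 : Tendsto t l (𝓝 t₀))
    (h2 : Tendsto x l (𝓝 x₀)) :
    Tendsto (fun a => φ.toFun (t a) (x a)) l (𝓝 (φ.toFun t₀ x₀)) := by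
  have hc := φ.continuousOn' (t₀, x₀) ⟨ht₀, trivial⟩
  have : Tendsto (fun a => (t a, x a)) l (𝓝[Ici (0:ℝ) ×ˢ univ] (t₀, x₀)) := by
    refine tendsto_nhdsWithin_iff.2 ⟨h1.prodMk_nhds h2, ?_⟩
    filter_upwards [ht] with a ha using ⟨ha, trivial⟩
  exact hc.tendsto.comp this

/-- Points of the omega-limit set (sequential version). -/
def auxOmega (φ : Semiflow E) (v₀ w : E) : Prop :=
  ∃ t : ℕ → ℝ, Tendsto t atTop atTop ∧ Tendsto (fun n => φ.toFun (t n) v₀) atTop (𝓝 w)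

theorem aux_pred (φ : Semiflow E) (v₀ : E) (hcpt : IsCompact (closure (φ.orbit v₀)))
    (w : E) (hw : auxOmega φ v₀ w) : ∃ w', auxOmega φ v₀ w' ∧ φ.toFun 1 w' = w := by
  obtain ⟨t, ht, hw⟩ := hw
  have hev : ∀ᶠ n in atTop, 0 ≤ t n - 1 := by
    filter_upwards [ht.eventually_ge_atTop 1] with n hn
    linarith
  have hK : ∀ᶠ n in atTop, φ.toFun (t n - 1) v₀ ∈ closure (φ.orbit v₀) := by
    filter_upwards [hev] with n hn
    exact subset_closure ⟨_, hn, rfl⟩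
  obtain ⟨w', -, ψ, hψ, hlim⟩ := hcpt.tendsto_subseq' hK.frequently
  refine ⟨w', ⟨fun n => t (ψ n) - 1, ?_, hlim⟩, ?_⟩
  · exact tendsto_atTop_add_const_right _ (-1) (ht.comp hψ.tendsto_atTop)
  · have h1 := aux_tendsto φ (fun _ : ℕ => (1:ℝ)) _ 1 w' zero_le_one
      (Eventually.of_forall fun _ => zero_le_one) tendsto_const_nhds hlim
    refine tendsto_nhds_unique h1 ((hw.comp hψ.tendsto_atTop).congr' ?_)
    filter_upwards [hψ.tendsto_atTop.eventually hev] with n hn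
    simp only [Function.comp]
    rw [← φ.map_add' 1 _ zero_le_one hn]
    congr 1
    ring

theorem aux_amenable (ι : E →L[ℝ] H) (φ : Semiflow E) (ν : ℝ) (hν : 0 < ν) (v₀ : E)
    (hcpt : IsCompact (closure (φ.orbit v₀))) (w : E) (hw : auxOmega φ v₀ w) :
    w ∈ φ.amenableSet ι ν := by
  choose! f hf1 hf2 using fun w (hw : auxOmega φ v₀ w) => aux_pred φ v₀ hcpt w hw
  let W : ℕ → E := fun k => f^[k] w
  have hW : ∀ k, auxOmega φ v₀ (W k) := by
    intro k
    induction k with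
    | zero => exact hw
    | succ k ih =>
      simp only [W, Function.iterate_succ_apply'] at ih ⊢
      exact hf1 _ ih
  have hW1 : ∀ k, φ.toFun 1 (W (k + 1)) = W k := by
    intro k
    have := hf2 _ (hW k)
    simpa only [W, Function.iterate_succ_apply'] using this
  have hcons : ∀ (m k : ℕ) (s : ℝ), 0 ≤ s + k →
      φ.toFun (s + (k + m : ℕ)) (W (k + m)) = φ.toFun (s + k) (W k) := by
    intro m k s hs
    induction m with
    | zero => simp
    | succ m ih =>
      rw [← ih, ← hW1 (k + m), ← φ.map_add' _ 1 (by push_cast; linarith [Nat.cast_nonneg (α := ℝ) m])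
        zero_le_one, ← add_assoc]
      congr 1
      push_cast
      ring
  let v : ℝ → E := fun s => φ.toFun (s + (⌈-s⌉₊ : ℕ)) (W ⌈-s⌉₊)
  have hvk : ∀ (k : ℕ) (s : ℝ), 0 ≤ s + k → v s = φ.toFun (s + k) (W k) := by
    intro k s hs
    have hle : ⌈-s⌉₊ ≤ k := Nat.ceil_le.2 (by linarith)
    obtain ⟨m, rfl⟩ := Nat.exists_eq_add_of_le hle
    exact (hcons m _ s (by linarith [Nat.le_ceil (-s)])).symm
  have hex : ∀ s : ℝ, ∃ k : ℕ, 0 < s + k := by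
    intro s
    obtain ⟨k, hk⟩ := exists_nat_gt (-s)
    exact ⟨k, by linarith⟩
  have hvc : Continuous v := by
    rw [continuous_iff_continuousAt]
    intro s
    obtain ⟨k, hk⟩ := hex s
    have hev : ∀ᶠ x in 𝓝 s, 0 ≤ x + (k : ℝ) := by
      filter_upwards [lt_mem_nhds (show -(k:ℝ) < s by linarith)] with x hx
      linarith
    have h := aux_tendsto φ (l := 𝓝 s) (fun x => x + (k : ℝ)) (fun _ => W k) (s + k) (W k) hk.le hev
      ((continuous_id.add continuous_const).tendsto s) tendsto_const_nhds
    rw [ContinuousAt, hvk k s hk.le]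
    refine h.congr' ?_
    filter_upwards [hev] with x hx
    exact (hvk k x hx).symm
  have hvt : ∀ t : ℝ, 0 ≤ t → ∀ s : ℝ, v (t + s) = φ.toFun t (v s) := by
    intro t ht s
    obtain ⟨k, hk⟩ := hex s
    rw [hvk k s hk.le, hvk k (t + s) (by linarith), ← φ.map_add' t _ ht hk.le, add_assoc]
  have hvK : ∀ s, v s ∈ closure (φ.orbit v₀) := by
    intro s
    obtain ⟨k, hk⟩ := hex s
    rw [hvk k s hk.le]
    obtain ⟨t, ht, hlim⟩ := hW k
    have h := aux_tendsto φ (fun _ : ℕ => s + (k : ℝ)) _ (s + k) (W k) hk.le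
      (Eventually.of_forall fun _ => hk.le) tendsto_const_nhds hlim
    refine mem_closure_of_tendsto h ?_
    filter_upwards [ht.eventually_ge_atTop 0] with n hn
    exact ⟨s + k + t n, by linarith, φ.map_add' _ _ hk.le hn _⟩
  obtain ⟨M, hM⟩ := hcpt.isBounded.exists_norm_le
  refine ⟨v, ⟨⟨hvc, hvt⟩, ?_⟩, ?_⟩
  · have hi : IntegrableOn (fun s : ℝ => Real.exp (2 * ν * s) * (‖ι‖ * M) ^ 2) (Iic 0) :=
      (integrableOn_exp_mul_Iic (by linarith : 0 < 2 * ν) 0).mul_const _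
    refine Integrable.mono' hi ?_ (Eventually.of_forall fun s => ?_)
    · have : Continuous (fun s : ℝ => Real.exp (2 * ν * s) * ‖ι (v s)‖ ^ 2) := by fun_prop
      exact this.aestronglyMeasurable
    · rw [Real.norm_of_nonneg (by positivity)]
      refine mul_le_mul_of_nonneg_left ?_ (Real.exp_pos _).le
      refine pow_le_pow_left₀ (norm_nonneg _) ?_ 2
      exact (ι.le_opNorm _).trans (mul_le_mul_of_nonneg_left (hM _ (hvK s)) (norm_nonneg _))
  · rw [hvk 0 0 (by simp)]
    simp [φ.map_zero', W]

end Helpers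

/-- Corollary 4 ((A3)): every point with precompact positive semi-orbit is attracted
by the inertial manifold `𝔄`: `‖φ^t(v₀) − Φ(Π φ^t(v₀))‖_E → 0` as `t → +∞`. -/
theorem attraction_to_amenableSet
    {E : Type*} [NormedAddCommGroup E] [NormedSpace ℝ E]
    {H : Type*} [NormedAddCommGroup H] [InnerProductSpace ℝ H]
    (ι : E →L[ℝ] H) (hι : Function.Injective ι)
    (φ : Semiflow E)
    (P : E →L[ℝ] E →L[ℝ] ℝ) (Eplus Eminus : Submodule ℝ E)
    (hH1 : Semiflow.IsH1 P Eplus Eminus)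
    (j : ℕ) [FiniteDimensional ℝ ↥Eminus] (hH2 : Module.finrank ℝ ↥Eminus = j)
    (δ τV ν : ℝ) (hH3 : φ.IsH3 ι P δ τV ν)
    (hCOM : φ.IsCOM) (hS : φ.IsSmoothing ι)
    (hne : (φ.amenableSet ι ν).Nonempty)
    (Pi : E → E) (hPi : Semiflow.IsVProjector P Eminus Pi)
    (Phi : E → E)
    (hPhi₁ : ∀ ζ ∈ Eminus, Phi ζ ∈ φ.amenableSet ι ν ∧ Pi (Phi ζ) = ζ)
    (hPhi₂ : ∀ a ∈ φ.amenableSet ι ν, Phi (Pi a) = a)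
    (v₀ : E) (hcpt : IsCompact (closure (φ.orbit v₀))) :
    Filter.Tendsto (fun t : ℝ => ‖φ.toFun t v₀ - Phi (Pi (φ.toFun t v₀))‖)
      Filter.atTop (nhds 0) := by
  obtain ⟨τ, C, hτ, hC, hSm⟩ := hS
  have hν : 0 < ν := hH3.2.2.1
  have hδ : 0 < δ := hH3.1
  obtain ⟨c, hc, hbound⟩ := aux_bound P Eminus hH1.2.2.2.2.2
  refine tendsto_of_subseq_tendsto fun t ht => ?_
  have hK : ∀ᶠ n in atTop, φ.toFun (t n) v₀ ∈ closure (φ.orbit v₀) := by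
    filter_upwards [ht.eventually_ge_atTop 0] with n hn
    exact subset_closure ⟨_, hn, rfl⟩
  obtain ⟨w, -, σ, hσ, hlim⟩ := hcpt.tendsto_subseq' hK.frequently
  obtain ⟨v, hv, hv0⟩ := aux_amenable ι φ ν hν v₀ hcpt w
    ⟨fun n => t (σ n), ht.comp hσ.tendsto_atTop, hlim⟩
  choose A hA using fun n => (hPhi₁ (Pi (φ.toFun (t (σ n)) v₀)) (hPi _).1)
  choose u hu hu0 using A
  choose s hs hest using fun n => aux_key ι φ P δ τV ν hH3 τ C hτ hC hSm (u n) v (hu n) hv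
  obtain ⟨s₀, hs₀, ψ, hψ, hslim⟩ := (isCompact_Icc (a := (-2:ℝ)) (b := -1)).tendsto_subseq hs
  set B : ℝ := C ^ 2 * Real.exp (2 * ν * (τ + 2)) / δ with hB
  have hB0 : 0 ≤ B := by positivity
  have hest2 : ∀ n, ‖u n (s n) - v (s n)‖ ^ 2 ≤
      B * (c * ‖φ.toFun (t (σ n)) v₀ - w‖ ^ 2) := by
    intro n
    refine (hest n).trans (mul_le_mul_of_nonneg_left ?_ hB0)
    set x := φ.toFun (t (σ n)) v₀ with hx
    have hz : Pi x - Pi w ∈ Eminus := Eminus.sub_mem (hPi x).1 (hPi w).1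
    have h1 : P (Pi x - Pi w) (Pi x - Pi w) ≤ P (u n 0 - v 0) (u n 0 - v 0) := by
      refine aux_V_le P Eplus Eminus hH1 _ _ hz fun y hy => ?_
      rw [map_sub, map_sub, hu0, hv0, (hPi (Phi (Pi x))).2 y hy, (hPi w).2 y hy, hA n]
    have h2 := hbound _ hz (x - w) fun y hy => by
      rw [map_sub, map_sub, (hPi x).2 y hy, (hPi w).2 y hy]
    linarith
  have hz1 : Tendsto (fun n => φ.toFun (t (σ n)) v₀ - w) atTop (𝓝 0) := by
    have := hlim.sub_const w
    simpa using this
  have hz2 : Tendsto (fun n => B * (c * ‖φ.toFun (t (σ n)) v₀ - w‖ ^ 2)) atTop (𝓝 0) := by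
    have := ((hz1.norm.pow 2).const_mul c).const_mul B
    simpa using this
  have hz3 : Tendsto (fun n => ‖u n (s n) - v (s n)‖ ^ 2) atTop (𝓝 0) :=
    squeeze_zero (fun n => sq_nonneg _) hest2 hz2
  have hz4 : Tendsto (fun n => u n (s n) - v (s n)) atTop (𝓝 0) := by
    rw [tendsto_zero_iff_norm_tendsto_zero]
    have := hz3.sqrt
    simpa [Real.sqrt_sq] using this
  have hvlim : Tendsto (fun n => v (s (ψ n))) atTop (𝓝 (v s₀)) :=
    (hv.1.1.tendsto s₀).comp hslim
  have hulim : Tendsto (fun n => u (ψ n) (s (ψ n))) atTop (𝓝 (v s₀)) := by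
    have := (hz4.comp hψ.tendsto_atTop).add hvlim
    simpa [Function.comp] using this
  have hfin := aux_tendsto φ (fun n => - s (ψ n)) _ (-s₀) (v s₀) (by linarith [hs₀.2])
    (Eventually.of_forall fun n => by linarith [(hs (ψ n)).2]) hslim.neg hulim
  rw [← hv.1.2 (-s₀) (by linarith [hs₀.2]), neg_add_cancel, hv0] at hfin
  have hfin2 : Tendsto (fun n => Phi (Pi (φ.toFun (t (σ (ψ n))) v₀))) atTop (𝓝 w) := by
    refine hfin.congr fun n => ?_
    rw [← (hu (ψ n)).1.2 (-s (ψ n)) (by linarith [(hs (ψ n)).2]), neg_add_cancel, hu0]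
  refine ⟨fun n => σ (ψ n), ?_⟩
  have := ((hlim.comp hψ.tendsto_atTop).sub hfin2).norm
  simpa [Function.comp] using this
end

section
/- Let X be a two-dimensional topological manifold and ξ a flow on X. Then for every non-stationary point x₀ of ξ (i.e., ξ^t(x₀) ≠ x₀ for some t ∈ ℝ) there exists ε₀ > 0 such that for every ε ∈ (0, ε₀] there exists an ε-transversal of ξ at x₀. -/
open Set Filter Topology MeasureTheory Bornology

theorem TF.lift_log {A : Type*} [TopologicalSpace A] (H : unitInterval × A → ℂ) (hH : Continuous H)
    (hne : ∀ p, H p ≠ 0) (f : A → ℂ) (hf : Continuous f) (h0 : ∀ a, Complex.exp (f a) = H (0, a)) :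
    ∃ L : A → ℂ, Continuous L ∧ ∀ a, Complex.exp (L a) = H (1, a) := by
  let H' : C(unitInterval × A, {z : ℂ // z ≠ 0}) :=
    ⟨fun p => ⟨H p, hne p⟩, hH.subtype_mk _⟩
  let f' : C(A, ℂ) := ⟨f, hf⟩
  have h0' : ∀ a, H' (0, a) = ⟨Complex.exp (f' a), Complex.exp_ne_zero _⟩ := fun a =>
    Subtype.ext (h0 a).symm
  let G := Complex.isCoveringMap_exp.liftHomotopy H' f' h0'
  refine ⟨fun a => G (1, a), by fun_prop, fun a => ?_⟩
  have := congr_fun (Complex.isCoveringMap_exp.liftHomotopy_lifts H' f' h0') (1, a)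
  exact congrArg Subtype.val this

theorem TF.const_of_exp {A : Type*} [TopologicalSpace A] {f : A → ℂ} {s : Set A}
    (hs : IsPreconnected s) (hf : ContinuousOn f s) (h : ∀ x ∈ s, Complex.exp (f x) = 1)
    {x y : A} (hx : x ∈ s) (hy : y ∈ s) : f x = f y := by
  have := isPreconnected_iff_preconnectedSpace.1 hs
  have := Complex.isCoveringMap_exp.eq_of_comp_eq (A := s) (g₁ := fun a => f a)
    (g₂ := fun _ => f x) (continuousOn_iff_continuous_domRestrict.1 hf) continuous_const
    (by
      funext a
      apply Subtype.ext
      simp [h _ a.2, h _ hx]) ⟨x, hx⟩ rfl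
  exact (congr_fun this ⟨y, hy⟩).symm

/-- `w - p` has no continuous logarithm on a punctured disc. -/
theorem TF.no_log {p : ℂ} {r : ℝ} (hr : 0 < r) {L : ℂ → ℂ}
    (hL : ContinuousOn L (Metric.ball p r \ {p}))
    (h : ∀ w ∈ Metric.ball p r \ {p}, Complex.exp (L w) = w - p) : False := by
  let c : ℝ → ℂ := fun θ => p + Complex.exp (Real.log (r / 2) + θ * Complex.I)
  have hc : Continuous c := by fun_prop
  have hcm : ∀ θ, c θ ∈ Metric.ball p r \ {p} := by
    intro θ
    constructor
    · simp [c, Complex.norm_exp, Real.exp_log (half_pos hr), hr]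
    · simp [c]
  have := TF.const_of_exp (A := ℝ) (s := univ)
    (f := fun θ => L (c θ) - (Real.log (r / 2) + θ * Complex.I)) isPreconnected_univ
    (by
      have := hL.comp_continuous hc hcm
      exact (this.sub (by fun_prop)).continuousOn)
    (by
      intro θ _
      rw [Complex.exp_sub, h _ (hcm θ)]
      simp [c, Complex.exp_ne_zero])
    (mem_univ 0) (mem_univ (2 * Real.pi))
  have e : c 0 = c (2 * Real.pi) := by
    simp only [c]
    rw [Complex.exp_add, Complex.exp_add]
    push_cast
    rw [Complex.exp_two_pi_mul_I]
    simp
  rw [e] at this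
  have h2 : ((2 * Real.pi : ℝ) : ℂ) * Complex.I = 0 := by
    push_cast at this ⊢
    linear_combination this
  simp [Real.pi_ne_zero] at h2

/-- A nonvanishing function on a punctured disc is a power times an exponential. -/
theorem TF.punctured_disc {p : ℂ} {r : ℝ} (hr : 0 < r) {F : ℂ → ℂ}
    (hF : ContinuousOn F (Metric.ball p r \ {p})) (hF0 : ∀ w ∈ Metric.ball p r \ {p}, F w ≠ 0) :
    ∃ (m : ℤ) (Λ : ℂ → ℂ), ContinuousOn Λ (Metric.ball p r \ {p}) ∧
      ∀ w ∈ Metric.ball p r \ {p}, F w = (w - p) ^ m * Complex.exp (Λ w) := by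
  let Hp : Set ℂ := {u | u.re < Real.log r}
  have hHpo : IsOpen Hp := isOpen_lt Complex.continuous_re continuous_const
  have hHpc : Convex ℝ Hp := convex_halfSpace_re_lt _
  have hmem : ∀ u ∈ Hp, p + Complex.exp u ∈ Metric.ball p r \ {p} := by
    intro u hu
    constructor
    · have : u.re < Real.log r := hu
      simp [Complex.norm_exp, (Real.lt_log_iff_exp_lt hr).1 this]
    · simp
  let u0 : Hp := ⟨((Real.log r - 1 : ℝ) : ℂ), by
    show ((Real.log r - 1 : ℝ) : ℂ).re < Real.log r
    rw [Complex.ofReal_re]; linarith⟩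
  have hconv : ∀ (t : unitInterval) (u : Hp), (u0 : ℂ) + ((t : ℝ) : ℂ) * ((u : ℂ) - u0) ∈ Hp := by
    intro t u
    have := hHpc.add_smul_sub_mem u0.2 u.2 t.2
    simpa using this
  obtain ⟨M', hM', hMe'⟩ := TF.lift_log (A := Hp)
    (fun q => F (p + Complex.exp ((u0 : ℂ) + ((q.1 : ℝ) : ℂ) * ((q.2 : ℂ) - u0))))
    (by
      refine hF.comp_continuous (by fun_prop) ?_
      intro q
      exact hmem _ (hconv q.1 q.2))
    (fun q => hF0 _ (hmem _ (hconv q.1 q.2)))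
    (fun _ => Complex.log (F (p + Complex.exp u0))) continuous_const
    (by
      intro a
      rw [Complex.exp_log (hF0 _ (hmem _ u0.2))]
      simp)
  let M : ℂ → ℂ := fun u => if h : u ∈ Hp then M' ⟨u, h⟩ else 0
  have hM : ContinuousOn M Hp := by
    rw [continuousOn_iff_continuous_domRestrict]
    convert! hM' using 1
    funext u
    simp [M]
  have hMe : ∀ u ∈ Hp, Complex.exp (M u) = F (p + Complex.exp u) := by
    intro u hu
    simp only [M, hu, dif_pos]
    rw [hMe']
    simp
  have hsh : ∀ u ∈ Hp, ∀ n : ℤ, u + n * (2 * Real.pi * Complex.I) ∈ Hp := by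
    intro u hu n
    have : u.re < Real.log r := hu
    show (u + n * (2 * Real.pi * Complex.I)).re < Real.log r
    simpa using this
  have hexpsh : ∀ (u : ℂ) (n : ℤ), Complex.exp (u + n * (2 * Real.pi * Complex.I)) = Complex.exp u := by
    intro u n
    rw [Complex.exp_add, Complex.exp_int_mul_two_pi_mul_I, mul_one]
  have hD : ∀ u ∈ Hp, M (u + 2 * Real.pi * Complex.I) - M u
      = M (u0 + 2 * Real.pi * Complex.I) - M u0 := by
    intro u hu
    refine TF.const_of_exp (f := fun u => M (u + 2 * Real.pi * Complex.I) - M u)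
      hHpc.isPreconnected ?_ ?_ hu u0.2
    · refine ContinuousOn.sub (hM.comp (by fun_prop) ?_) hM
      intro u hu
      simpa using hsh u hu 1
    · intro u hu
      have h1 := hsh u hu 1
      have h2 := hexpsh u 1
      simp only [Int.cast_one, one_mul] at h1 h2
      rw [Complex.exp_sub, hMe _ h1, hMe _ hu, h2, div_self (hF0 _ (hmem u hu))]
  obtain ⟨m, hm⟩ : ∃ m : ℤ, M (u0 + 2 * Real.pi * Complex.I) - M u0 = m * (2 * Real.pi * Complex.I) := by
    apply Complex.exp_eq_one_iff.1
    have h1 := hsh u0 u0.2 1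
    have h2 := hexpsh u0 1
    simp only [Int.cast_one, one_mul] at h1 h2
    rw [Complex.exp_sub, hMe _ h1, hMe _ u0.2, h2, div_self (hF0 _ (hmem u0 u0.2))]
  let Q : ℂ → ℂ := fun u => M u - m * u
  have hQ : ContinuousOn Q Hp := hM.sub (by fun_prop)
  have hQ1 : ∀ u ∈ Hp, Q (u + 2 * Real.pi * Complex.I) = Q u := by
    intro u hu
    have := hD u hu
    simp only [Q]
    linear_combination this + hm
  have hQn : ∀ n : ℤ, ∀ u ∈ Hp, Q (u + n * (2 * Real.pi * Complex.I)) = Q u := by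
    intro n
    induction n using Int.induction_on with
    | zero => intro u hu; simp
    | succ i ih =>
      intro u hu
      rw [← ih u hu, ← hQ1 _ (hsh u hu i)]
      congr 1
      push_cast; ring
    | pred i ih =>
      intro u hu
      rw [← ih u hu, ← hQ1 _ (hsh u hu _)]
      congr 1
      push_cast; ring
  have hlogmem : ∀ w ∈ Metric.ball p r \ {p}, ∀ u, Complex.exp u = w - p → u ∈ Hp := by
    intro w hw u hu
    show u.re < Real.log r
    rw [Real.lt_log_iff_exp_lt hr, ← Complex.norm_exp, hu]
    simpa [dist_eq_norm] using hw.1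
  have hsubne : ∀ w ∈ Metric.ball p r \ {p}, w - p ≠ 0 := fun w hw => sub_ne_zero.2 hw.2
  refine ⟨m, fun w => Q (Complex.log (w - p)), ?_, ?_⟩
  · intro w0 hw0
    have hopen : IsOpen (Metric.ball p r \ {p}) := Metric.isOpen_ball.sdiff isClosed_singleton
    apply ContinuousAt.continuousWithinAt
    let br : ℂ → ℂ := fun w => Complex.log ((w - p) / (w0 - p)) + Complex.log (w0 - p)
    have hbr : ContinuousAt br w0 := by
      have : ContinuousAt (fun w => Complex.log ((w - p) / (w0 - p))) w0 := by
        apply ContinuousAt.clog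
        · fun_prop
        · rw [div_self (hsubne _ hw0)]; simp
      exact this.add continuousAt_const
    have hbre : ∀ w ∈ Metric.ball p r \ {p}, Complex.exp (br w) = w - p := by
      intro w hw
      simp only [br]
      rw [Complex.exp_add, Complex.exp_log (div_ne_zero (hsubne _ hw) (hsubne _ hw0)),
        Complex.exp_log (hsubne _ hw0), div_mul_cancel₀ _ (hsubne _ hw0)]
    have hc : ContinuousAt (fun w => Q (br w)) w0 := by
      have hq : ContinuousAt Q (br w0) :=
        hQ.continuousAt (hHpo.mem_nhds (hlogmem _ hw0 _ (hbre _ hw0)))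
      exact ContinuousAt.comp (g := Q) hq hbr
    refine hc.congr ?_
    filter_upwards [hopen.mem_nhds hw0] with w hw
    have h1 := hbre w hw
    have h2 := Complex.exp_log (hsubne w hw)
    obtain ⟨n, hn⟩ := Complex.exp_eq_exp_iff_exists_int.1 (h1.trans h2.symm)
    rw [hn]
    exact hQn n _ (hlogmem w hw _ h2)
  · intro w hw
    have h2 := Complex.exp_log (hsubne w hw)
    have h3 := hMe _ (hlogmem w hw _ h2)
    simp only [Q]
    rw [Complex.exp_sub, h3, h2, Complex.exp_int_mul, h2]
    have : (w - p) ^ m ≠ 0 := zpow_ne_zero _ (hsubne w hw)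
    field_simp
    congr 1
    ring


/-- region where the point `(s,0)` is joined to the end `σ` -/
def TF.D (S : Type*) (σ : ℝ) : Set (S × S × ℝ) := {q | q.1 ≠ q.2.1 ∨ 0 < σ * q.2.2}

theorem TF.isOpen_D {S : Type*} [TopologicalSpace S] [T2Space S] (σ : ℝ) : IsOpen (TF.D S σ) := by
  have h1 : IsOpen {q : S × S × ℝ | q.1 ≠ q.2.1} :=
    isOpen_ne_fun (by fun_prop) (by fun_prop)
  have h2 : IsOpen {q : S × S × ℝ | 0 < σ * q.2.2} := isOpen_lt (by fun_prop) (by fun_prop)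
  exact h1.union h2

theorem TF.exists_L {S : Type*} [TopologicalSpace S] {z : S × ℝ → ℂ}
    (hz : IsOpenEmbedding z) {σ : ℝ} (hσ : σ ≠ 0)
    (hend : ∃ f : S × S → ℂ, Continuous f ∧ ∀ q, Complex.exp (f q) = z (q.1, σ) - z (q.2, 0)) :
    ∃ L : S × S × ℝ → ℂ, ContinuousOn L (TF.D S σ) ∧
      ∀ q ∈ TF.D S σ, Complex.exp (L q) = z (q.1, q.2.2) - z (q.2.1, 0) := by
  obtain ⟨f, hf, hfe⟩ := hend
  have hzc := hz.continuous
  obtain ⟨L', hL', hLe'⟩ := TF.lift_log (A := TF.D S σ)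
    (fun x => z (x.2.1.1, (1 - (x.1 : ℝ)) * σ + (x.1 : ℝ) * x.2.1.2.2) - z (x.2.1.2.1, 0))
    (by fun_prop)
    (by
      rintro ⟨u, ⟨⟨y, s, t⟩, h⟩⟩ h0
      have := hz.injective (sub_eq_zero.1 h0)
      simp only [Prod.mk.injEq] at this
      obtain ⟨h1, h2⟩ := this
      have h : y ≠ s ∨ 0 < σ * t := h
      have h3 : 0 < σ * t := h.resolve_left (fun hn => hn h1)
      have h4 : 0 < σ * σ := mul_self_pos.2 hσ
      have hu0 := u.2.1
      have hu1 := u.2.2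
      have h5 : (1 - (u : ℝ)) * (σ * σ) + u * (σ * t) = 0 := by
        linear_combination σ * h2
      rcases hu0.eq_or_lt with hu | hu
      · rw [← hu] at h5; linarith
      · nlinarith [mul_pos hu h3, mul_nonneg (sub_nonneg.2 hu1) h4.le])
    (fun a => f (a.1.1, a.1.2.1)) (by fun_prop)
    (by intro a; rw [hfe]; simp)
  classical
  refine ⟨fun q => if h : q ∈ TF.D S σ then L' ⟨q, h⟩ else 0, ?_, ?_⟩
  · rw [continuousOn_iff_continuous_domRestrict]
    convert! hL' using 1
    funext u
    simp
  · intro q hq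
    simp only [hq, dif_pos]
    rw [hLe']
    simp

theorem TF.exists_inv {S : Type*} [TopologicalSpace S] [Nonempty S] {z : S × ℝ → ℂ}
    (hz : IsOpenEmbedding z) : ∃ zi : ℂ → S × ℝ, (∀ q, zi (z q) = q) ∧
      ∀ q, ContinuousAt zi (z q) := by
  refine ⟨(hz.toOpenPartialHomeomorph z).symm, ?_, ?_⟩
  · intro q
    exact (hz.toOpenPartialHomeomorph z).left_inv (by simp)
  · intro q
    exact (hz.toOpenPartialHomeomorph z).symm.continuousAt (by simp)

theorem TF.nonconst {S : Type*} [TopologicalSpace S] [T2Space S] {z : S × ℝ → ℂ}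
    (hz : IsOpenEmbedding z) {Lp Lm : S × S × ℝ → ℂ}
    (hLp : ContinuousOn Lp (TF.D S 1)) (hLm : ContinuousOn Lm (TF.D S (-1)))
    (hLpe : ∀ q ∈ TF.D S 1, Complex.exp (Lp q) = z (q.1, q.2.2) - z (q.2.1, 0))
    (hLme : ∀ q ∈ TF.D S (-1), Complex.exp (Lm q) = z (q.1, q.2.2) - z (q.2.1, 0))
    {K : S → S → ℤ}
    (hK : ∀ y s t, y ≠ s → Lp (y, s, t) - Lm (y, s, t) = K y s * (2 * Real.pi * Complex.I))
    (s : S) {V : Set S} (hV : V ∈ 𝓝 s) (k : ℤ) : ∃ y ∈ V, y ≠ s ∧ K y s ≠ k := by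
  by_contra! hcon
  have : Nonempty S := ⟨s⟩
  obtain ⟨zi, hzi, hzic⟩ := TF.exists_inv hz
  classical
  obtain ⟨V', hV'V, hV'o, hsV'⟩ := mem_nhds_iff.1 hV
  let L : S × ℝ → ℂ := fun q => if (q.1, s, q.2) ∈ TF.D S 1 then Lp (q.1, s, q.2)
    else Lm (q.1, s, q.2) + k * (2 * Real.pi * Complex.I)
  have hj : Continuous (fun q : S × ℝ => (q.1, s, q.2)) := by fun_prop
  have hLm' : ∀ q : S × ℝ, q.1 ∈ V' → (q.1, s, q.2) ∈ TF.D S (-1) →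
      L q = Lm (q.1, s, q.2) + k * (2 * Real.pi * Complex.I) := by
    rintro ⟨y, t⟩ hy hq
    simp only [L]
    split_ifs with h
    · have hys : y ≠ s := by
        intro h0
        rcases h with h | h
        · exact h h0
        · rcases hq with hq | hq
          · exact hq h0
          · simp only at h hq; linarith
      rw [← hcon y (hV'V hy) hys, ← hK y s t hys]; ring
    · rfl
  have hcov : ∀ q : S × ℝ, q ≠ (s, 0) → (q.1, s, q.2) ∈ TF.D S 1 ∨ (q.1, s, q.2) ∈ TF.D S (-1) := by
    rintro ⟨y, t⟩ hq
    by_cases h : y = s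
    · have ht : t ≠ 0 := fun h0 => hq (by rw [h, h0])
      rcases lt_or_gt_of_ne ht with h | h
      · right; right; simpa using h
      · left; right; simpa using h
    · left; left; exact h
  have hLc : ∀ q : S × ℝ, q.1 ∈ V' → q ≠ (s, 0) → ContinuousAt L q := by
    intro q hqV hq
    rcases hcov q hq with h | h
    · have h1 : ContinuousAt (fun q : S × ℝ => Lp (q.1, s, q.2)) q :=
        ContinuousAt.comp (g := Lp) (f := fun q : S × ℝ => (q.1, s, q.2))
          (hLp.continuousAt ((TF.isOpen_D 1).mem_nhds h)) hj.continuousAt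
      refine h1.congr ?_
      filter_upwards [hj.continuousAt.preimage_mem_nhds ((TF.isOpen_D 1).mem_nhds h)] with q' hq'
      exact (if_pos hq').symm
    · have h1 : ContinuousAt (fun q : S × ℝ => Lm (q.1, s, q.2)) q :=
        ContinuousAt.comp (g := Lm) (f := fun q : S × ℝ => (q.1, s, q.2))
          (hLm.continuousAt ((TF.isOpen_D (-1)).mem_nhds h)) hj.continuousAt
      have h2 : ContinuousAt (fun q : S × ℝ => Lm (q.1, s, q.2) + k * (2 * Real.pi * Complex.I)) q :=
        h1.add continuousAt_const
      refine h2.congr ?_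
      filter_upwards [hj.continuousAt.preimage_mem_nhds ((TF.isOpen_D (-1)).mem_nhds h),
        continuous_fst.continuousAt.preimage_mem_nhds (hV'o.mem_nhds hqV)] with q' hq' hq2
      exact (hLm' q' hq2 hq').symm
  have hLe : ∀ q : S × ℝ, q.1 ∈ V' → q ≠ (s, 0) → Complex.exp (L q) = z q - z (s, 0) := by
    intro q hqV hq
    by_cases h : (q.1, s, q.2) ∈ TF.D S 1
    · simp only [L, h, if_true]
      exact hLpe _ h
    · have h' := (hcov q hq).resolve_left h
      rw [hLm' q hqV h', Complex.exp_add, hLme _ h', Complex.exp_int_mul_two_pi_mul_I, mul_one]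
  have hO : z '' (Prod.fst ⁻¹' V') ∈ 𝓝 (z (s, 0)) :=
    (hz.isOpenMap _ (hV'o.preimage continuous_fst)).mem_nhds ⟨(s, 0), hsV', rfl⟩
  obtain ⟨r, hr, hball⟩ := Metric.mem_nhds_iff.1 hO
  refine TF.no_log (p := z (s, 0)) hr (L := fun w => L (zi w)) ?_ ?_
  · rintro w ⟨hw, hwp⟩
    obtain ⟨q, hq, rfl⟩ := hball hw
    have hne : q ≠ (s, 0) := by rintro rfl; exact hwp rfl
    apply ContinuousAt.continuousWithinAt
    refine ContinuousAt.comp (g := L) ?_ (hzic q)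
    rw [hzi]
    exact hLc q hq hne
  · rintro w ⟨hw, hwp⟩
    obtain ⟨q, hq, rfl⟩ := hball hw
    have hne : q ≠ (s, 0) := by rintro rfl; exact hwp rfl
    simp only [hzi]
    exact hLe q hq hne

theorem TF.preconn {S : Type*} [TopologicalSpace S] {V : Set S} (hV : IsPreconnected V)
    (s : S) {η σ : ℝ} (hη : 0 < η) (hσ : σ = 1 ∨ σ = -1) :
    IsPreconnected {q : S × ℝ | q.1 ∈ V ∧ |q.2| < η ∧ (q.1 ≠ s ∨ 0 < σ * q.2)} := by
  rcases V.eq_empty_or_nonempty with rfl | ⟨v, hv⟩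
  · simp [isPreconnected_empty]
  have hc : |σ * (η / 2)| < η ∧ 0 < σ * (σ * (η / 2)) := by
    rcases hσ with rfl | rfl
    · rw [abs_lt]; refine ⟨⟨?_, ?_⟩, ?_⟩ <;> linarith
    · rw [abs_lt]; refine ⟨⟨?_, ?_⟩, ?_⟩ <;> linarith
  apply isPreconnected_of_forall (v, σ * (η / 2))
  rintro ⟨y, t⟩ ⟨hy, ht, hyt⟩
  let C : Set ℝ := {u | u ∈ Ioo (-η) η ∧ (y ≠ s ∨ 0 < σ * u)}
  have hC : IsPreconnected C := by
    apply Convex.isPreconnected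
    apply (convex_Ioo _ _).inter
    by_cases h : y ≠ s
    · have hu : {u : ℝ | y ≠ s ∨ 0 < σ * u} = univ := by simp [h]
      have hv : Convex ℝ {u : ℝ | y ≠ s ∨ 0 < σ * u} := by rw [hu]; exact convex_univ
      exact hv
    · simp only [h, false_or]
      have := (convex_Ioi (𝕜 := ℝ) (0 : ℝ)).linear_preimage (LinearMap.mulLeft ℝ σ)
      exact this
  refine ⟨V ×ˢ {σ * (η / 2)} ∪ {y} ×ˢ C, ?_, ?_, ?_, ?_⟩
  · rintro ⟨y', u⟩ (⟨h1, h2⟩ | ⟨h1, h2⟩)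
    · simp only [mem_singleton_iff] at h2
      subst h2
      exact ⟨h1, hc.1, Or.inr hc.2⟩
    · simp only [mem_singleton_iff] at h1
      subst h1
      exact ⟨hy, abs_lt.2 h2.1, h2.2⟩
  · left; exact ⟨hv, rfl⟩
  · right; exact ⟨rfl, abs_lt.1 ht, hyt⟩
  · refine IsPreconnected.union (y, σ * (η / 2)) ⟨hy, rfl⟩ ⟨rfl, abs_lt.1 hc.1, Or.inr hc.2⟩
      (hV.prod isPreconnected_singleton) (isPreconnected_singleton.prod hC)


/-- the function on the punctured box determined by a locally constant function -/
theorem TF.exists_Phi {S : Type*} [TopologicalSpace S] [T2Space S] {z : S × ℝ → ℂ}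
    (hz : IsOpenEmbedding z) (s : S) (φ : S → ℤ) (hφ : ∀ y, y ≠ s → ∀ᶠ y' in 𝓝 y, φ y' = φ y) :
    ∃ Φp Φm : S × ℝ → ℂ,
      (∀ q : S × ℝ, (q.1, s, q.2) ∈ TF.D S 1 → ContinuousAt Φp q) ∧
      (∀ q : S × ℝ, (q.1, s, q.2) ∈ TF.D S (-1) → ContinuousAt Φm q) ∧
      (∀ q, Complex.exp (Φp q) = Complex.exp (Φm q)) ∧
      (∀ y t, y ≠ s → Φp (y, t) - Φm (y, t) = - (φ y * (2 * Real.pi * Complex.I))) := by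
  classical
  have hzc := hz.continuous
  let d : S → ℝ := fun y => ‖z (y, 0) - z (s, 0)‖
  have hd : Continuous d := by fun_prop
  have hd0 : ∀ y, y ≠ s → 0 < d y := by
    intro y hy
    refine norm_pos_iff.2 (sub_ne_zero.2 fun h => hy ?_)
    exact congrArg Prod.fst (hz.injective h)
  have hds : d s = 0 := by simp [d]
  let ρ : S × ℝ → ℝ := fun q => max 0 (min 1 ((q.2 / d q.1 + 1) / 2))
  have hρ : ∀ q : S × ℝ, q.1 ≠ s → ContinuousAt ρ q := by
    intro q hq
    have h1 : ContinuousAt (fun q : S × ℝ => q.2 / d q.1) q :=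
      continuous_snd.continuousAt.div (by fun_prop) (hd0 _ hq).ne'
    have h2 : ContinuousAt (fun q : S × ℝ => (q.2 / d q.1 + 1) / 2) q :=
      (h1.add continuousAt_const).div_const 2
    exact continuousAt_const.max (continuousAt_const.min h2)
  have hφc : ∀ q : S × ℝ, q.1 ≠ s → ContinuousAt (fun q : S × ℝ => (φ q.1 : ℂ)) q := by
    intro q hq
    refine (continuousAt_const (y := (φ q.1 : ℂ))).congr ?_
    filter_upwards [continuous_fst.continuousAt.eventually (hφ q.1 hq)] with q' hq'
    rw [hq']
  have hne : ∀ q : S × ℝ, q.1 ≠ s → ∀ᶠ q' : S × ℝ in 𝓝 q, q'.1 ≠ s := fun q hq =>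
    continuous_fst.continuousAt.eventually (isOpen_ne.mem_nhds hq)
  let Φm : S × ℝ → ℂ := fun q => if q.1 = s then 0 else φ q.1 * (2 * Real.pi * Complex.I) * (ρ q : ℂ)
  let Φp : S × ℝ → ℂ := fun q => if q.1 = s then 0
    else φ q.1 * (2 * Real.pi * Complex.I) * ((ρ q : ℂ) - 1)
  refine ⟨Φp, Φm, ?_, ?_, ?_, ?_⟩
  · rintro q hq
    by_cases h : q.1 = s
    · obtain ⟨y, t⟩ := q
      have ht : 0 < t := by
        rcases hq with hq | hq
        · exact absurd h hq
        · simpa using hq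
      simp only at h
      subst h
      refine (continuousAt_const (y := (0 : ℂ))).congr ?_
      have e1 : ∀ᶠ q' : S × ℝ in 𝓝 (y, t), d q'.1 < q'.2 := by
        apply ContinuousAt.eventually_lt
        · fun_prop
        · fun_prop
        · simpa [hds] using ht
      filter_upwards [e1] with q' h1
      by_cases h2 : q'.1 = y
      · simp [Φp, h2]
      · have h3 : 1 < q'.2 / d q'.1 := (one_lt_div (hd0 _ h2)).2 h1
        have h4 : ρ q' = 1 := by
          simp only [ρ]
          rw [min_eq_left (by linarith), max_eq_right zero_le_one]
        simp [Φp, h2, h4]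
    · have h1 : ContinuousAt (fun q : S × ℝ => φ q.1 * (2 * Real.pi * Complex.I) * ((ρ q : ℂ) - 1)) q :=
        ((hφc q h).mul continuousAt_const).mul
          ((Complex.continuous_ofReal.continuousAt.comp (hρ q h)).sub continuousAt_const)
      refine h1.congr ?_
      filter_upwards [hne q h] with q' hq'
      simp [Φp, hq']
  · rintro q hq
    by_cases h : q.1 = s
    · obtain ⟨y, t⟩ := q
      have ht : t < 0 := by
        rcases hq with hq | hq
        · exact absurd h hq
        · simpa using hq
      simp only at h
      subst h
      refine (continuousAt_const (y := (0 : ℂ))).congr ?_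
      have e1 : ∀ᶠ q' : S × ℝ in 𝓝 (y, t), d q'.1 < - q'.2 := by
        apply ContinuousAt.eventually_lt
        · fun_prop
        · fun_prop
        · simpa [hds] using ht
      filter_upwards [e1] with q' h1
      by_cases h2 : q'.1 = y
      · simp [Φm, h2]
      · have h3 : q'.2 / d q'.1 < -1 := by
          rw [div_lt_iff₀ (hd0 _ h2)]; linarith
        have h4 : ρ q' = 0 := by
          simp only [ρ]
          rw [max_eq_left]
          exact (min_le_right _ _).trans (by linarith)
        simp [Φm, h2, h4]
    · have h1 : ContinuousAt (fun q : S × ℝ => φ q.1 * (2 * Real.pi * Complex.I) * (ρ q : ℂ)) q :=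
        ((hφc q h).mul continuousAt_const).mul
          (Complex.continuous_ofReal.continuousAt.comp (hρ q h))
      refine h1.congr ?_
      filter_upwards [hne q h] with q' hq'
      simp [Φm, hq']
  · intro q
    by_cases h : q.1 = s
    · simp [Φp, Φm, h]
    · simp only [Φp, Φm, h, if_false]
      rw [mul_sub, Complex.exp_sub, mul_one, Complex.exp_int_mul_two_pi_mul_I, div_one]
  · intro y t hy
    simp only [Φp, Φm, hy, if_false]
    ring

theorem TF.affine {S : Type*} [TopologicalSpace S] [T2Space S] [LocallyConnectedSpace S]
    {z : S × ℝ → ℂ}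
    (hz : IsOpenEmbedding z) {Lp Lm : S × S × ℝ → ℂ}
    (hLp : ContinuousOn Lp (TF.D S 1)) (hLm : ContinuousOn Lm (TF.D S (-1)))
    (hLpe : ∀ q ∈ TF.D S 1, Complex.exp (Lp q) = z (q.1, q.2.2) - z (q.2.1, 0))
    (hLme : ∀ q ∈ TF.D S (-1), Complex.exp (Lm q) = z (q.1, q.2.2) - z (q.2.1, 0))
    {K : S → S → ℤ}
    (hK : ∀ y s t, y ≠ s → Lp (y, s, t) - Lm (y, s, t) = K y s * (2 * Real.pi * Complex.I))
    (s : S) (φ : S → ℤ) (hφ : ∀ y, y ≠ s → ∀ᶠ y' in 𝓝 y, φ y' = φ y) :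
    ∃ m : ℤ, ∃ V ∈ 𝓝 s, ∀ y ∈ V, ∀ y' ∈ V, y ≠ s → y' ≠ s →
      φ y - φ y' = m * (K y' s - K y s) := by
  have : Nonempty S := ⟨s⟩
  obtain ⟨zi, hzi, hzic⟩ := TF.exists_inv hz
  obtain ⟨Φp, Φm, hΦp, hΦm, hΦe, hΦ⟩ := TF.exists_Phi hz s φ hφ
  have hcov : ∀ q : S × ℝ, q ≠ (s, 0) → (q.1, s, q.2) ∈ TF.D S 1 ∨ (q.1, s, q.2) ∈ TF.D S (-1) := by
    rintro ⟨y, t⟩ hq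
    by_cases h : y = s
    · have ht : t ≠ 0 := fun h0 => hq (by rw [h, h0])
      rcases lt_or_gt_of_ne ht with h | h
      · right; right; simpa using h
      · left; right; simpa using h
    · left; left; exact h
  have hj : Continuous (fun q : S × ℝ => (q.1, s, q.2)) := by fun_prop
  have hF : ∀ q : S × ℝ, q ≠ (s, 0) → ContinuousAt (fun q => Complex.exp (Φp q)) q := by
    intro q hq
    rcases hcov q hq with h | h
    · exact (hΦp q h).cexp
    · simp_rw [hΦe]
      exact (hΦm q h).cexp
  have hO : range z ∈ 𝓝 (z (s, 0)) := hz.isOpen_range.mem_nhds ⟨_, rfl⟩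
  obtain ⟨r, hr, hball⟩ := Metric.mem_nhds_iff.1 hO
  obtain ⟨m, Λ, hΛ, hΛe⟩ := TF.punctured_disc (p := z (s, 0)) hr
    (F := fun w => Complex.exp (Φp (zi w)))
    (by
      rintro w ⟨hw, hwp⟩
      obtain ⟨q, rfl⟩ := hball hw
      have hne : q ≠ (s, 0) := by rintro rfl; exact hwp rfl
      apply ContinuousAt.continuousWithinAt
      refine ContinuousAt.comp (g := fun q => Complex.exp (Φp q)) ?_ (hzic q)
      rw [hzi]
      exact hF q hne)
    (fun w _ => Complex.exp_ne_zero _)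
  have hpre : z ⁻¹' Metric.ball (z (s, 0)) r ∈ 𝓝 (s, (0 : ℝ)) :=
    hz.continuous.continuousAt.preimage_mem_nhds (Metric.ball_mem_nhds _ hr)
  rw [nhds_prod_eq, mem_prod_iff] at hpre
  obtain ⟨A, hA, B, hB, hAB⟩ := hpre
  obtain ⟨η, hη, hηB⟩ := Metric.mem_nhds_iff.1 hB
  obtain ⟨V, hVA, hVo, hsV, hVc⟩ :=
    locallyConnectedSpace_iff_subsets_isOpen_isConnected.1 inferInstance s A hA
  have hbox : ∀ q : S × ℝ, q.1 ∈ V → |q.2| < η → z q ∈ Metric.ball (z (s, 0)) r := by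
    intro q h1 h2
    apply hAB
    exact ⟨hVA h1, hηB (by simpa [Real.dist_eq] using h2)⟩
  have key : ∀ (σ : ℝ) (hσ : σ = 1 ∨ σ = -1) (L : S × S × ℝ → ℂ) (Φ : S × ℝ → ℂ)
      (hL : ContinuousOn L (TF.D S σ))
      (hLe : ∀ q ∈ TF.D S σ, Complex.exp (L q) = z (q.1, q.2.2) - z (q.2.1, 0))
      (hΦ : ∀ q : S × ℝ, (q.1, s, q.2) ∈ TF.D S σ → ContinuousAt Φ q)
      (hΦ' : ∀ q, Complex.exp (Φ q) = Complex.exp (Φp q)), 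
      ∀ y ∈ V, ∀ y' ∈ V, y ≠ s → y' ≠ s →
        Φ (y, 0) - m * L (y, s, 0) - Λ (z (y, 0)) = Φ (y', 0) - m * L (y', s, 0) - Λ (z (y', 0)) := by
    intro σ hσ L Φ hL hLe hΦ hΦ' y hy y' hy' hys hy's
    refine TF.const_of_exp (A := S × ℝ)
      (f := fun q => Φ q - m * L (q.1, s, q.2) - Λ (z q))
      (TF.preconn hVc.isPreconnected s hη hσ) ?_ ?_
      (x := (y, 0)) (y := (y', 0)) ⟨hy, by simpa using hη, Or.inl hys⟩
      ⟨hy', by simpa using hη, Or.inl hy's⟩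
    · rintro q ⟨h1, h2, h3⟩
      have hD : (q.1, s, q.2) ∈ TF.D S σ := h3
      apply ContinuousAt.continuousWithinAt
      have c1 : ContinuousAt (fun q : S × ℝ => L (q.1, s, q.2)) q :=
        ContinuousAt.comp (g := L) (f := fun q : S × ℝ => (q.1, s, q.2))
          (hL.continuousAt ((TF.isOpen_D σ).mem_nhds hD)) hj.continuousAt
      have hne : z q ≠ z (s, 0) := by
        intro h0
        have := hz.injective h0
        subst this
        simp at h3
      have c2 : ContinuousAt (fun q : S × ℝ => Λ (z q)) q := by
        refine ContinuousAt.comp (g := Λ) (hΛ.continuousAt ?_) hz.continuous.continuousAt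
        exact (Metric.isOpen_ball.sdiff isClosed_singleton).mem_nhds ⟨hbox q h1 h2, hne⟩
      exact ((hΦ q hD).sub (continuousAt_const.mul c1)).sub c2
    · rintro q ⟨h1, h2, h3⟩
      have hD : (q.1, s, q.2) ∈ TF.D S σ := h3
      have hne : z q ≠ z (s, 0) := by
        intro h0
        have := hz.injective h0
        subst this
        simp at h3
      have e1 := hΛe (z q) ⟨hbox q h1 h2, hne⟩
      have e2 := hLe _ hD
      simp only [hzi] at e1 e2
      rw [Complex.exp_sub, Complex.exp_sub, Complex.exp_int_mul, hΦ', e1, e2]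
      have : (z q - z (s, 0)) ^ m ≠ 0 := zpow_ne_zero _ (sub_ne_zero.2 hne)
      have := Complex.exp_ne_zero (Λ (z q))
      field_simp
  refine ⟨m, V, hVo.mem_nhds hsV, ?_⟩
  intro y hy y' hy' hys hy's
  have k1 := key 1 (Or.inl rfl) Lp Φp hLp hLpe hΦp (fun _ => rfl) y hy y' hy' hys hy's
  have k2 := key (-1) (Or.inr rfl) Lm Φm hLm hLme hΦm (fun q => (hΦe q).symm) y hy y' hy' hys hy's
  have a1 := hΦ y 0 hys
  have a2 := hΦ y' 0 hy's
  have b1 := hK y s 0 hys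
  have b2 := hK y' s 0 hy's
  have h2pi : (2 * Real.pi * Complex.I : ℂ) ≠ 0 := Complex.two_pi_I_ne_zero
  have : ((φ y - φ y' : ℤ) : ℂ) = ((m * (K y' s - K y s) : ℤ) : ℂ) := by
    apply mul_right_cancel₀ h2pi
    push_cast
    linear_combination k2 - k1 + a1 - a2 - m * b1 + m * b2
  exact_mod_cast this


theorem TF.exists_K {S : Type*} [TopologicalSpace S] [T2Space S] {z : S × ℝ → ℂ}
    {Lp Lm : S × S × ℝ → ℂ}
    (hLp : ContinuousOn Lp (TF.D S 1)) (hLm : ContinuousOn Lm (TF.D S (-1)))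
    (hLpe : ∀ q ∈ TF.D S 1, Complex.exp (Lp q) = z (q.1, q.2.2) - z (q.2.1, 0))
    (hLme : ∀ q ∈ TF.D S (-1), Complex.exp (Lm q) = z (q.1, q.2.2) - z (q.2.1, 0)) :
    ∃ K : S → S → ℤ,
      (∀ y s t, y ≠ s → Lp (y, s, t) - Lm (y, s, t) = K y s * (2 * Real.pi * Complex.I)) ∧
      ∀ y s, y ≠ s → ∀ᶠ q : S × S in 𝓝 (y, s), K q.1 q.2 = K y s := by
  classical
  have hc : ∀ y s t, y ≠ s → ContinuousAt (fun q => Lp q - Lm q) (y, s, t) := by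
    intro y s t h
    exact (hLp.continuousAt ((TF.isOpen_D 1).mem_nhds (Or.inl h))).sub
      (hLm.continuousAt ((TF.isOpen_D (-1)).mem_nhds (Or.inl h)))
  have he : ∀ y s t, y ≠ s → Complex.exp (Lp (y, s, t) - Lm (y, s, t)) = 1 := by
    intro y s t h
    rw [Complex.exp_sub, hLpe _ (Or.inl h), hLme _ (Or.inl h)]
    apply div_self
    rw [← hLpe (y, s, t) (Or.inl h)]
    exact Complex.exp_ne_zero _
  have h1 : ∀ y s, ∃ k : ℤ, y ≠ s → Lp (y, s, 0) - Lm (y, s, 0) = k * (2 * Real.pi * Complex.I) := by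
    intro y s
    by_cases h : y = s
    · exact ⟨0, fun h' => absurd h h'⟩
    · obtain ⟨k, hk⟩ := Complex.exp_eq_one_iff.1 (he y s 0 h)
      exact ⟨k, fun _ => hk⟩
  choose K hK using h1
  refine ⟨K, ?_, ?_⟩
  · intro y s t h
    rw [← hK y s h]
    refine TF.const_of_exp (A := ℝ) (f := fun t => Lp (y, s, t) - Lm (y, s, t))
      isPreconnected_univ ?_ ?_ (mem_univ t) (mem_univ 0)
    · intro t _
      apply ContinuousAt.continuousWithinAt
      exact ContinuousAt.comp (g := fun q => Lp q - Lm q) (f := fun t : ℝ => (y, s, t))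
        (hc y s t h) (by fun_prop)
    · intro t _
      exact he y s t h
  · intro y s h
    have c1 : ContinuousAt (fun q : S × S => Lp (q.1, q.2, 0) - Lm (q.1, q.2, 0)) (y, s) :=
      ContinuousAt.comp (g := fun q => Lp q - Lm q) (f := fun q : S × S => (q.1, q.2, (0 : ℝ)))
        (hc y s 0 h) (by fun_prop)
    have c2 := Metric.continuousAt_iff'.1 c1 (2 * Real.pi) Real.two_pi_pos
    have c3 : ∀ᶠ q : S × S in 𝓝 (y, s), q.1 ≠ q.2 :=
      (isOpen_ne_fun continuous_fst continuous_snd).mem_nhds h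
    filter_upwards [c2, c3] with q h2 h3
    rw [hK _ _ h3, hK _ _ h, dist_eq_norm, ← sub_mul, norm_mul, ← Int.cast_sub] at h2
    have h4 : ‖(2 * Real.pi * Complex.I : ℂ)‖ = 2 * Real.pi := by
      simp [abs_of_pos Real.pi_pos]
    rw [h4] at h2
    have h5 : ‖((K q.1 q.2 - K y s : ℤ) : ℂ)‖ < 1 := by
      have := Real.two_pi_pos
      by_contra! hh
      nlinarith
    rw [Complex.norm_intCast] at h5
    have h6 : |K q.1 q.2 - K y s| < 1 := by exact_mod_cast h5
    have := Int.abs_lt_one_iff.1 h6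
    omega

theorem TF.accum {S : Type*} [TopologicalSpace S] [PreconnectedSpace S] {A B : Set S} {s : S}
    (hA : IsOpen A) (hB : IsOpen B) (hAB : Disjoint A B) (hs : s ∉ A)
    (hcov : ∀ y, y ≠ s → y ∈ A ∪ B) (hne : A.Nonempty) {V : Set S} (hV : V ∈ 𝓝 s) :
    ∃ a ∈ V, a ∈ A := by
  by_contra! hcon
  have hcl : IsClosed A := by
    rw [← isOpen_compl_iff, isOpen_iff_mem_nhds]
    intro y hy
    by_cases h : y = s
    · subst h
      exact mem_of_superset hV hcon
    · rcases hcov y h with h1 | h1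
      · exact absurd h1 hy
      · exact mem_of_superset (hB.mem_nhds h1) (fun b hb ha => hAB.le_bot ⟨ha, hb⟩)
  have := IsClopen.eq_univ ⟨hcl, hA⟩ hne
  exact hs (this ▸ mem_univ s)

theorem TF.claimC {S : Type*} [TopologicalSpace S] [PreconnectedSpace S] [T2Space S]
    {K : S → S → ℤ}
    (haff : ∀ (s : S) (φ : S → ℤ), (∀ y, y ≠ s → ∀ᶠ y' in 𝓝 y, φ y' = φ y) →
      ∃ m : ℤ, ∃ V ∈ 𝓝 s, ∀ y ∈ V, ∀ y' ∈ V, y ≠ s → y' ≠ s →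
      φ y - φ y' = m * (K y' s - K y s))
    (s : S) {A B C : Set S} (hA : IsOpen A) (hB : IsOpen B) (hC : IsOpen C)
    (hAB : Disjoint A B) (hAC : Disjoint A C) (hBC : Disjoint B C)
    (hsA : s ∉ A) (hsB : s ∉ B) (hsC : s ∉ C) (hcov : ∀ y, y ≠ s → y ∈ A ∨ y ∈ B ∨ y ∈ C)
    (nA : A.Nonempty) (nB : B.Nonempty) (nC : C.Nonempty) : False := by
  classical
  have hloc : ∀ E F : Set S, IsOpen E → IsOpen F → Disjoint E F →
      (∀ y, y ≠ s → y ∈ E ∨ y ∈ F) →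
      ∀ y, y ≠ s → ∀ᶠ y' in 𝓝 y, (if y' ∈ E then (1 : ℤ) else 0) = if y ∈ E then 1 else 0 := by
    intro E F hE hF hEF hc y hy
    rcases hc y hy with h | h
    · filter_upwards [hE.mem_nhds h] with y' hy'
      rw [if_pos h, if_pos hy']
    · filter_upwards [hF.mem_nhds h] with y' hy'
      rw [if_neg (fun h' => hEF.le_bot ⟨h', h⟩), if_neg (fun h' => hEF.le_bot ⟨h', hy'⟩)]
  obtain ⟨m, V, hV, h1⟩ := haff s _ (hloc A (B ∪ C) hA (hB.union hC)
    (disjoint_union_right.2 ⟨hAB, hAC⟩) hcov)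
  obtain ⟨m', V', hV', h2⟩ := haff s _ (hloc B (A ∪ C) hB (hA.union hC)
    (disjoint_union_right.2 ⟨hAB.symm, hBC⟩) (by intro y hy; have := hcov y hy; simp only [mem_union]; tauto))
  obtain ⟨a, haV, ha⟩ := TF.accum hA (hB.union hC) (disjoint_union_right.2 ⟨hAB, hAC⟩) hsA
    (by intro y hy; have := hcov y hy; simp only [mem_union]; tauto) nA (inter_mem hV hV')
  obtain ⟨b, hbV, hb⟩ := TF.accum hB (hA.union hC) (disjoint_union_right.2 ⟨hAB.symm, hBC⟩) hsB
    (by intro y hy; have := hcov y hy; simp only [mem_union]; tauto) nB (inter_mem hV hV')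
  obtain ⟨c, hcV, hc⟩ := TF.accum hC (hA.union hB) (disjoint_union_right.2 ⟨hAC.symm, hBC.symm⟩) hsC
    (by intro y hy; have := hcov y hy; simp only [mem_union]; tauto) nC (inter_mem hV hV')
  have has : a ≠ s := fun h => hsA (h ▸ ha)
  have hbs : b ≠ s := fun h => hsB (h ▸ hb)
  have hcs : c ≠ s := fun h => hsC (h ▸ hc)
  have hbA : b ∉ A := fun h => hAB.le_bot ⟨h, hb⟩
  have hcA : c ∉ A := fun h => hAC.le_bot ⟨h, hc⟩
  have hcB : c ∉ B := fun h => hBC.le_bot ⟨h, hc⟩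
  have e1 := h1 a haV.1 c hcV.1 has hcs
  have e2 := h1 b hbV.1 c hcV.1 hbs hcs
  have e3 := h2 b hbV.2 c hcV.2 hbs hcs
  rw [if_pos ha, if_neg hcA] at e1
  rw [if_neg hbA, if_neg hcA] at e2
  rw [if_pos hb, if_neg hcB] at e3
  have hm : m ≠ 0 := by rintro rfl; simp at e1
  have : K c s - K b s = 0 := by
    have : m * (K c s - K b s) = 0 := by rw [← e2]; simp
    exact (mul_eq_zero.1 this).resolve_left hm
  rw [this] at e3
  simp at e3

/-- pair of relations given by the two sides -/
structure TF.Sides {S : Type*} [TopologicalSpace S] (P Q : S → S → Prop) : Prop where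
  oP : IsOpen {q : S × S | P q.1 q.2}
  oQ : IsOpen {q : S × S | Q q.1 q.2}
  iP : ∀ s, ¬ P s s
  iQ : ∀ s, ¬ Q s s
  dis : ∀ y s, P y s → ¬ Q y s
  cov : ∀ y s, y ≠ s → P y s ∨ Q y s
  pP : ∀ s, IsPreconnected {y | P y s}
  pQ : ∀ s, IsPreconnected {y | Q y s}
  aP : ∀ s, ∀ V ∈ 𝓝 s, ∃ y ∈ V, P y s
  aQ : ∀ s, ∀ V ∈ 𝓝 s, ∃ y ∈ V, Q y s

theorem TF.Sides.symm {S : Type*} [TopologicalSpace S] {P Q : S → S → Prop}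
    (h : TF.Sides P Q) : TF.Sides Q P :=
  ⟨h.oQ, h.oP, h.iQ, h.iP, fun y s h1 h2 => h.dis y s h2 h1, fun y s hy => (h.cov y s hy).symm,
    h.pQ, h.pP, h.aQ, h.aP⟩

theorem TF.Sides.side {S : Type*} [TopologicalSpace S] {P Q : S → S → Prop}
    (h : TF.Sides P Q) {V : Set S} (hV : IsPreconnected V) {s : S} (hs : s ∉ V) {x : S}
    (hx : x ∈ V) (hxs : P x s) : ∀ y ∈ V, P y s := by
  have o1 : IsOpen {y | P y s} := h.oP.preimage (f := fun y => (y, s)) (by fun_prop)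
  have o2 : IsOpen {y | Q y s} := h.oQ.preimage (f := fun y => (y, s)) (by fun_prop)
  have hsub : V ⊆ {y | P y s} := by
    refine IsPreconnected.subset_left_of_subset_union o1 o2 ?_ ?_ ⟨x, hx, hxs⟩ hV
    · rw [Set.disjoint_left]; exact fun y => h.dis y s
    · exact fun y hy => h.cov y s (fun h0 => hs (h0 ▸ hy))
  exact hsub

theorem TF.Sides.pPs {S : Type*} [TopologicalSpace S] {P Q : S → S → Prop}
    (h : TF.Sides P Q) (s : S) : IsPreconnected {y | y = s ∨ P y s} := by
  refine (h.pP s).subset_closure (fun y hy => Or.inr hy) ?_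
  rintro y (rfl | hy)
  · rw [mem_closure_iff_nhds]
    intro V hV
    obtain ⟨x, h1, h2⟩ := h.aP y V hV
    exact ⟨x, h1, h2⟩
  · exact subset_closure hy

theorem TF.Sides.anti {S : Type*} [TopologicalSpace S] {P Q : S → S → Prop}
    (h : TF.Sides P Q) {y s : S} (hQ : Q y s) : P s y := by
  by_contra hP
  have hne : s ≠ y := fun h0 => h.iQ s (by subst h0; exact hQ)
  have hQ' : Q s y := (h.cov s y hne).resolve_left hP
  have o1 : IsOpen {y | P s y} := h.oP.preimage (f := fun y => (s, y)) (by fun_prop)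
  have o2 : IsOpen {y | Q s y} := h.oQ.preimage (f := fun y => (s, y)) (by fun_prop)
  have hall : {y | Q y s} ⊆ {y | Q s y} := by
    refine IsPreconnected.subset_left_of_subset_union o2 o1 ?_ ?_ ⟨y, hQ, hQ'⟩ (h.pQ s)
    · rw [Set.disjoint_left]; exact fun y h1 h2 => h.dis s y h2 h1
    · exact fun y hy => (h.cov s y (fun h0 => h.iQ s (by subst h0; exact hy))).symm
  obtain ⟨x, -, hx⟩ := h.aP s univ univ_mem
  have o3 : IsOpen {y | P x y} := h.oP.preimage (f := fun y => (x, y)) (by fun_prop)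
  obtain ⟨y', hy'1, hy'2⟩ := h.aQ s _ (o3.mem_nhds hx)
  have hq : Q s y' := hall hy'2
  refine h.dis x y' hy'1 (h.symm.side (h.pPs s) ?_ (Or.inl rfl) hq x (Or.inr hx))
  rintro (h0 | h0)
  · subst h0; exact h.iQ _ hq
  · exact h.dis _ _ h0 hy'2

theorem TF.Sides.trans {S : Type*} [TopologicalSpace S] {P Q : S → S → Prop}
    (h : TF.Sides P Q) {x y s : S} (h1 : P x y) (h2 : P y s) : P x s := by
  refine h.side (h.pPs y) ?_ (Or.inl rfl) h2 x (Or.inr h1)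
  rintro (h0 | h0)
  · subst h0; exact h.iP _ h2
  · exact h.dis _ _ h0 (h.symm.anti h2)

theorem TF.exists_sides {S : Type*} [TopologicalSpace S] [PreconnectedSpace S] [T2Space S]
    {K : S → S → ℤ}
    (hloc : ∀ y s, y ≠ s → ∀ᶠ q : S × S in 𝓝 (y, s), K q.1 q.2 = K y s)
    (hnc : ∀ s, ∀ V ∈ 𝓝 s, ∀ k, ∃ y ∈ V, y ≠ s ∧ K y s ≠ k)
    (haff : ∀ (s : S) (φ : S → ℤ), (∀ y, y ≠ s → ∀ᶠ y' in 𝓝 y, φ y' = φ y) →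
      ∃ m : ℤ, ∃ V ∈ 𝓝 s, ∀ y ∈ V, ∀ y' ∈ V, y ≠ s → y' ≠ s →
      φ y - φ y' = m * (K y' s - K y s)) :
    TF.Sides (fun y s => y ≠ s ∧ ∃ y', y' ≠ s ∧ K y' s < K y s)
      (fun y s => y ≠ s ∧ ∃ y', y' ≠ s ∧ K y s < K y' s) := by
  have hne : ∀ y s : S, y ≠ s → ∀ᶠ q : S × S in 𝓝 (y, s), q.1 ≠ q.2 := fun y s h =>
    (isOpen_ne_fun continuous_fst continuous_snd).mem_nhds h
  have hl2 : ∀ y y' s : S, y' ≠ s → ∀ᶠ q : S × S in 𝓝 (y, s), y' ≠ q.2 ∧ K y' q.2 = K y' s := by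
    intro y y' s h
    have : Tendsto (fun q : S × S => (y', q.2)) (𝓝 (y, s)) (𝓝 (y', s)) :=
      Continuous.tendsto' (by fun_prop) _ _ rfl
    exact this.eventually ((hne y' s h).and (hloc y' s h))
  have hset : ∀ (s : S) (E : Set ℤ), IsOpen {y | y ≠ s ∧ K y s ∈ E} := by
    intro s E
    rw [isOpen_iff_mem_nhds]
    rintro y ⟨h1, h2⟩
    have : Tendsto (fun q : S => (q, s)) (𝓝 y) (𝓝 (y, s)) :=
      Continuous.tendsto' (by fun_prop) _ _ rfl
    filter_upwards [this.eventually ((hne y s h1).and (hloc y s h1))] with y' hy'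
    exact ⟨hy'.1, by rw [hy'.2]; exact h2⟩
  have oP : IsOpen {q : S × S | q.1 ≠ q.2 ∧ ∃ y', y' ≠ q.2 ∧ K y' q.2 < K q.1 q.2} := by
    rw [isOpen_iff_mem_nhds]
    rintro ⟨y, s⟩ ⟨h1, y', h2, h3⟩
    filter_upwards [hne y s h1, hloc y s h1, hl2 y y' s h2] with q a1 a2 a3
    exact ⟨a1, y', a3.1, by rw [a2, a3.2]; exact h3⟩
  have oQ : IsOpen {q : S × S | q.1 ≠ q.2 ∧ ∃ y', y' ≠ q.2 ∧ K q.1 q.2 < K y' q.2} := by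
    rw [isOpen_iff_mem_nhds]
    rintro ⟨y, s⟩ ⟨h1, y', h2, h3⟩
    filter_upwards [hne y s h1, hloc y s h1, hl2 y y' s h2] with q a1 a2 a3
    exact ⟨a1, y', a3.1, by rw [a2, a3.2]; exact h3⟩
  have dis : ∀ y s, (y ≠ s ∧ ∃ y', y' ≠ s ∧ K y' s < K y s) →
      ¬ (y ≠ s ∧ ∃ y', y' ≠ s ∧ K y s < K y' s) := by
    rintro y s ⟨h1, y1, h2, h3⟩ ⟨-, y2, h4, h5⟩
    refine TF.claimC haff s (hset s (Iio (K y s))) (hset s {K y s}) (hset s (Ioi (K y s)))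
      ?_ ?_ ?_ (fun h => h.1 rfl) (fun h => h.1 rfl) (fun h => h.1 rfl) ?_
      ⟨y1, h2, h3⟩ ⟨y, h1, rfl⟩ ⟨y2, h4, h5⟩
    · rw [Set.disjoint_left]; rintro x ⟨-, a⟩ ⟨-, b⟩; simp at a b; omega
    · rw [Set.disjoint_left]; rintro x ⟨-, a⟩ ⟨-, b⟩; simp at a b; omega
    · rw [Set.disjoint_left]; rintro x ⟨-, a⟩ ⟨-, b⟩; simp at a b; omega
    · intro x hx
      rcases lt_trichotomy (K x s) (K y s) with h | h | h
      · left; exact ⟨hx, h⟩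
      · right; left; exact ⟨hx, h⟩
      · right; right; exact ⟨hx, h⟩
  have cov : ∀ y s, y ≠ s → (y ≠ s ∧ ∃ y', y' ≠ s ∧ K y' s < K y s) ∨
      (y ≠ s ∧ ∃ y', y' ≠ s ∧ K y s < K y' s) := by
    intro y s h
    obtain ⟨y', -, h1, h2⟩ := hnc s univ univ_mem (K y s)
    rcases lt_or_gt_of_ne h2 with h3 | h3
    · left; exact ⟨h, y', h1, h3⟩
    · right; exact ⟨h, y', h1, h3⟩
  have oPs : ∀ s, IsOpen {y | y ≠ s ∧ ∃ y', y' ≠ s ∧ K y' s < K y s} := fun s =>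
    oP.preimage (f := fun y => (y, s)) (by fun_prop)
  have oQs : ∀ s, IsOpen {y | y ≠ s ∧ ∃ y', y' ≠ s ∧ K y s < K y' s} := fun s =>
    oQ.preimage (f := fun y => (y, s)) (by fun_prop)
  have dj : ∀ s, Disjoint {y | y ≠ s ∧ ∃ y', y' ≠ s ∧ K y' s < K y s}
      {y | y ≠ s ∧ ∃ y', y' ≠ s ∧ K y s < K y' s} := fun s =>
    Set.disjoint_left.2 (fun y => dis y s)
  have ne : ∀ s, ∃ y1 y2, y1 ≠ s ∧ y2 ≠ s ∧ K y1 s < K y2 s := by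
    intro s
    obtain ⟨y1, -, h1, h2⟩ := hnc s univ univ_mem 0
    obtain ⟨y2, -, h3, h4⟩ := hnc s univ univ_mem (K y1 s)
    rcases lt_or_gt_of_ne h4 with h | h
    · exact ⟨y2, y1, h3, h1, h⟩
    · exact ⟨y1, y2, h1, h3, h⟩
  have nP : ∀ s, {y | y ≠ s ∧ ∃ y', y' ≠ s ∧ K y' s < K y s}.Nonempty := by
    intro s
    obtain ⟨y1, y2, h1, h2, h3⟩ := ne s
    exact ⟨y2, h2, y1, h1, h3⟩
  have nQ : ∀ s, {y | y ≠ s ∧ ∃ y', y' ≠ s ∧ K y s < K y' s}.Nonempty := by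
    intro s
    obtain ⟨y1, y2, h1, h2, h3⟩ := ne s
    exact ⟨y1, h1, y2, h2, h3⟩
  have pre : ∀ (s : S) (A C : Set S), IsOpen A → IsOpen C → Disjoint A C → s ∉ A → s ∉ C →
      (∀ y, y ≠ s → y ∈ A ∨ y ∈ C) → C.Nonempty → IsPreconnected A := by
    intro s A C hA hC hAC hsA hsC hcov nC u v hu hv huv hAu hAv
    by_contra hcon
    have hcon : ∀ x, x ∈ A → x ∈ u → x ∉ v := fun x h1 h2 h3 => hcon ⟨x, h1, h2, h3⟩
    refine TF.claimC haff s (hA.inter hu) (hA.inter hv) hC ?_ ?_ ?_ (fun h => hsA h.1)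
      (fun h => hsA h.1) hsC ?_ hAu hAv nC
    · rw [Set.disjoint_left]; rintro x ⟨a, b⟩ ⟨c, d⟩; exact hcon x a b d
    · exact hAC.mono_left inter_subset_left
    · exact hAC.mono_left inter_subset_left
    · intro y hy
      rcases hcov y hy with h | h
      · rcases huv h with h' | h'
        · left; exact ⟨h, h'⟩
        · right; left; exact ⟨h, h'⟩
      · right; right; exact h
  refine ⟨oP, oQ, fun s h => h.1 rfl, fun s h => h.1 rfl, dis, cov, ?_, ?_, ?_, ?_⟩
  · intro s
    exact pre s _ _ (oPs s) (oQs s) (dj s) (fun h => h.1 rfl) (fun h => h.1 rfl)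
      (fun y hy => cov y s hy) (nQ s)
  · intro s
    exact pre s _ _ (oQs s) (oPs s) (dj s).symm (fun h => h.1 rfl) (fun h => h.1 rfl)
      (fun y hy => (cov y s hy).symm) (nP s)
  · intro s V hV
    exact TF.accum (oPs s) (oQs s) (dj s) (fun h => h.1 rfl) (fun y hy => cov y s hy) (nP s) hV
  · intro s V hV
    exact TF.accum (oQs s) (oPs s) (dj s).symm (fun h => h.1 rfl)
      (fun y hy => (cov y s hy).symm) (nQ s) hV

theorem TF.exists_order {S : Type*} [TopologicalSpace S] [PreconnectedSpace S] [T2Space S]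
    [LocallyConnectedSpace S] {z : S × ℝ → ℂ} (hz : IsOpenEmbedding z)
    (hp : ∃ f : S × S → ℂ, Continuous f ∧ ∀ q, Complex.exp (f q) = z (q.1, 1) - z (q.2, 0))
    (hm : ∃ f : S × S → ℂ, Continuous f ∧ ∀ q, Complex.exp (f q) = z (q.1, -1) - z (q.2, 0)) :
    ∃ P Q : S → S → Prop, TF.Sides P Q := by
  obtain ⟨Lp, hLp, hLpe⟩ := TF.exists_L hz one_ne_zero hp
  obtain ⟨Lm, hLm, hLme⟩ := TF.exists_L hz (neg_ne_zero.2 one_ne_zero) hm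
  obtain ⟨K, hK, hloc⟩ := TF.exists_K hLp hLm hLpe hLme
  exact ⟨_, _, TF.exists_sides hloc
    (fun s V hV k => TF.nonconst hz hLp hLm hLpe hLme hK s hV k)
    (fun s φ hφ => TF.affine hz hLp hLm hLpe hLme hK s φ hφ)⟩


theorem TF.exists_g {S : Type*} [TopologicalSpace S] [LocallyConnectedSpace S]
    {P Q : S → S → Prop} (h : TF.Sides P Q) {e : S → ℂ} (he : IsEmbedding e) :
    ∃ g : S → ℝ, Continuous g ∧ ∀ x s, P x s → g s < g x := by
  let A : S → Set S := fun s => {x | x = s ∨ P x s}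
  let G : ℕ → S → ℝ := fun n s => min 1 (Metric.infDist (TopologicalSpace.denseSeq ℂ n) (e '' A s))
  have hAne : ∀ s, (e '' A s).Nonempty := fun s => ⟨e s, s, Or.inl rfl, rfl⟩
  have hAcl : ∀ s, IsClosed (A s) := by
    intro s
    have o2 : IsOpen {y | Q y s} := h.oQ.preimage (f := fun y => (y, s)) (by fun_prop)
    rw [← isOpen_compl_iff]
    convert o2 using 1
    ext y
    simp only [A, mem_compl_iff, mem_ofPred_eq, not_or]
    constructor
    · rintro ⟨h1, h2⟩
      exact (h.cov y s h1).resolve_left h2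
    · intro h1
      exact ⟨fun h0 => h.iQ s (by subst h0; exact h1), fun h0 => h.dis y s h0 h1⟩
  have hmove : ∀ V : Set S, IsPreconnected V → ∀ s ∈ V, ∀ y ∈ V, ∀ x ∈ A s, x ∉ V → x ∈ A y := by
    intro V hV s hs y hy x hx hxV
    rcases hx with rfl | hx
    · exact absurd hs hxV
    · right
      exact h.anti (h.symm.side hV hxV hs (h.symm.anti hx) y hy)
  have hle : ∀ (V : Set S) (ε : ℝ), IsPreconnected V → ∀ s ∈ V, ∀ y ∈ V, 0 ≤ ε →
      (∀ a ∈ V, ∀ b ∈ V, dist (e a) (e b) ≤ ε) → ∀ q,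
      Metric.infDist q (e '' A y) ≤ Metric.infDist q (e '' A s) + ε := by
    intro V ε hV s hs y hy hε hd q
    rw [← sub_le_iff_le_add, Metric.le_infDist (hAne s)]
    rintro _ ⟨x, hx, rfl⟩
    by_cases hxV : x ∈ V
    · have h1 : Metric.infDist q (e '' A y) ≤ dist q (e y) :=
        Metric.infDist_le_dist_of_mem ⟨y, Or.inl rfl, rfl⟩
      have h2 := dist_triangle q (e x) (e y)
      have h3 := hd x hxV y hy
      linarith
    · have h1 : Metric.infDist q (e '' A y) ≤ dist q (e x) :=
        Metric.infDist_le_dist_of_mem ⟨x, hmove V hV s hs y hy x hx hxV, rfl⟩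
      linarith
  have hGc : ∀ n, Continuous (G n) := by
    intro n
    have : Continuous (fun s => Metric.infDist (TopologicalSpace.denseSeq ℂ n) (e '' A s)) := by
      rw [continuous_iff_continuousAt]
      intro s
      rw [Metric.continuousAt_iff']
      intro ε hε
      have hb : e ⁻¹' Metric.ball (e s) (ε / 4) ∈ 𝓝 s :=
        he.continuous.continuousAt.preimage_mem_nhds (Metric.ball_mem_nhds _ (by linarith))
      obtain ⟨V, hVA, hVo, hsV, hVc⟩ :=
        locallyConnectedSpace_iff_subsets_isOpen_isConnected.1 inferInstance s _ hb
      have hd : ∀ a ∈ V, ∀ b ∈ V, dist (e a) (e b) ≤ ε / 2 := by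
        intro a ha b hb
        have h1 := dist_triangle_right (e a) (e b) (e s)
        have h2 : dist (e a) (e s) < ε / 4 := hVA ha
        have h3 : dist (e b) (e s) < ε / 4 := hVA hb
        linarith
      filter_upwards [hVo.mem_nhds hsV] with y hy
      have h1 := hle V (ε / 2) hVc.isPreconnected s hsV y hy (by linarith) hd
        (TopologicalSpace.denseSeq ℂ n)
      have h2 := hle V (ε / 2) hVc.isPreconnected y hy s hsV (by linarith) hd
        (TopologicalSpace.denseSeq ℂ n)
      rw [Real.dist_eq, abs_lt]
      constructor <;> linarith
    exact continuous_const.min this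
  have hG0 : ∀ n s, 0 ≤ G n s := fun n s => le_min zero_le_one Metric.infDist_nonneg
  have hG1 : ∀ n s, G n s ≤ 1 := fun n s => min_le_left _ _
  have hsum : Summable (fun n : ℕ => (1 / 2 : ℝ) ^ n) := summable_geometric_two
  have hbd : ∀ n s, ‖(1 / 2 : ℝ) ^ n * G n s‖ ≤ (1 / 2 : ℝ) ^ n := by
    intro n s
    rw [Real.norm_of_nonneg (mul_nonneg (by positivity) (hG0 n s))]
    exact mul_le_of_le_one_right (by positivity) (hG1 n s)
  have hsm : ∀ s, Summable (fun n : ℕ => (1 / 2 : ℝ) ^ n * G n s) := fun s =>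
    Summable.of_norm_bounded hsum (fun n => hbd n s)
  refine ⟨fun s => ∑' n : ℕ, (1 / 2 : ℝ) ^ n * G n s, ?_, ?_⟩
  · exact continuous_tsum (fun n => continuous_const.mul (hGc n)) hsum hbd
  · intro x s hxs
    have hsub : A x ⊆ A s := by
      rintro y (rfl | hy)
      · exact Or.inr hxs
      · exact Or.inr (h.trans hy hxs)
    have hmono : ∀ n, G n s ≤ G n x := by
      intro n
      exact min_le_min le_rfl
        (Metric.infDist_le_infDist_of_subset (image_mono hsub) (hAne x))
    have hsx : s ∉ A x := by
      rintro (h0 | h0)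
      · subst h0; exact h.iP _ hxs
      · exact h.dis _ _ h0 (h.symm.anti hxs)
    have hpos : 0 < Metric.infDist (e s) (e '' A x) := by
      rw [← Metric.infDist_pos_iff_notMem_closure (hAne x)]
      intro h0
      apply hsx
      have h1 : s ∈ e ⁻¹' closure (e '' A x) := h0
      rwa [← he.isInducing.closure_eq_preimage_closure_image, (hAcl x).closure_eq] at h1
    let d := min 1 (Metric.infDist (e s) (e '' A x))
    have hd : 0 < d := lt_min zero_lt_one hpos
    have hd1 : d ≤ 1 := min_le_left _ _
    have hd2 : d ≤ Metric.infDist (e s) (e '' A x) := min_le_right _ _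
    obtain ⟨n, hn⟩ := (TopologicalSpace.denseRange_denseSeq ℂ).exists_dist_lt (e s)
      (show 0 < d / 4 by linarith)
    refine Summable.tsum_lt_tsum (i := n)
      (fun m => mul_le_mul_of_nonneg_left (hmono m) (by positivity)) ?_ (hsm s) (hsm x)
    refine mul_lt_mul_of_pos_left ?_ (by positivity)
    have h1 : Metric.infDist (TopologicalSpace.denseSeq ℂ n) (e '' A s) ≤
        dist (TopologicalSpace.denseSeq ℂ n) (e s) :=
      Metric.infDist_le_dist_of_mem ⟨s, Or.inl rfl, rfl⟩
    have h2 : Metric.infDist (e s) (e '' A x) ≤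
        Metric.infDist (TopologicalSpace.denseSeq ℂ n) (e '' A x) +
          dist (e s) (TopologicalSpace.denseSeq ℂ n) := Metric.infDist_le_infDist_add_dist
    rw [dist_comm] at h1
    refine lt_of_le_of_lt (min_le_right _ _) (lt_min ?_ ?_) <;> linarith

theorem TF.arc {S : Type*} [TopologicalSpace S] [T2Space S] [LocallyConnectedSpace S]
    [LocallyCompactSpace S] {P Q : S → S → Prop} (h : TF.Sides P Q) {e : S → ℂ}
    (he : IsEmbedding e) (x₀ : S) :
    ∃ Ks ∈ 𝓝 x₀, ∃ h : ℝ → S, ContinuousOn h (Icc (-1) 1) ∧ InjOn h (Icc (-1) 1) ∧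
      h '' Icc (-1) 1 = Ks ∧ ∃ s₀ ∈ Ioo (-1 : ℝ) 1, h s₀ = x₀ := by
  obtain ⟨g, hg, hmono⟩ := TF.exists_g h he
  have hinj : Function.Injective g := by
    intro x y hxy
    by_contra hne
    rcases h.cov x y hne with h1 | h1
    · exact (hmono x y h1).ne hxy.symm
    · exact (hmono y x (h.anti h1)).ne hxy
  obtain ⟨C, hC, hCx⟩ := exists_compact_mem_nhds x₀
  obtain ⟨V, hVC, hVo, hxV, hVc⟩ :=
    locallyConnectedSpace_iff_subsets_isOpen_isConnected.1 inferInstance x₀ C hCx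
  let Ks := closure V
  have hKc : IsCompact Ks := hC.closure_of_subset hVC
  have hKconn : IsConnected Ks := hVc.closure
  have hVK : V ⊆ Ks := subset_closure
  have hI : g '' Ks = Icc (sInf (g '' Ks)) (sSup (g '' Ks)) :=
    eq_Icc_of_connected_compact (hKconn.image g hg.continuousOn) (hKc.image hg)
  generalize sInf (g '' Ks) = α at hI
  generalize sSup (g '' Ks) = β at hI
  obtain ⟨y1, hy1, hP1⟩ := h.aP x₀ V (hVo.mem_nhds hxV)
  obtain ⟨y2, hy2, hQ2⟩ := h.aQ x₀ V (hVo.mem_nhds hxV)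
  have l1 : g x₀ < g y1 := hmono _ _ hP1
  have l2 : g y2 < g x₀ := hmono _ _ (h.anti hQ2)
  have m1 : g y1 ∈ Icc α β := hI ▸ mem_image_of_mem g (hVK hy1)
  have m2 : g y2 ∈ Icc α β := hI ▸ mem_image_of_mem g (hVK hy2)
  have hαβ : α < β := by linarith [m1.2, m2.1]
  have : CompactSpace Ks := isCompact_iff_compactSpace.1 hKc
  let f : Ks → ℝ := fun u => g u
  have hf : IsClosedEmbedding f := Continuous.isClosedEmbedding (by fun_prop)
    (fun a b hab => Subtype.ext (hinj hab))
  let H := hf.isEmbedding.toHomeomorph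
  have hr : range f = Icc α β := by
    rw [← hI]; ext t; simp [f]
  let φ : ℝ → ℝ := fun t => α + (t + 1) / 2 * (β - α)
  have hφ : ∀ t ∈ Icc (-1 : ℝ) 1, φ t ∈ range f := by
    intro t ht
    rw [hr]
    constructor
    · have : 0 ≤ (t + 1) / 2 * (β - α) := mul_nonneg (by linarith [ht.1]) (by linarith)
      simp only [φ]; linarith
    · have : (t + 1) / 2 * (β - α) ≤ 1 * (β - α) :=
        mul_le_mul_of_nonneg_right (by linarith [ht.2]) (by linarith)
      simp only [φ]; linarith
  have hφinj : Function.Injective φ := by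
    intro t t' htt
    simp only [φ] at htt
    have h1 : (t - t') * (β - α) = 0 := by linarith
    rcases mul_eq_zero.1 h1 with h2 | h2 <;> linarith
  have hφsurj : ∀ v, α ≤ v → v ≤ β → ∃ t ∈ Icc (-1 : ℝ) 1, φ t = v := by
    intro v h1 h2
    have hb : 0 < β - α := by linarith
    refine ⟨2 * ((v - α) / (β - α)) - 1, ⟨?_, ?_⟩, ?_⟩
    · have := div_nonneg (sub_nonneg.2 h1) hb.le
      linarith
    · have : (v - α) / (β - α) ≤ 1 := (div_le_one hb).2 (by linarith)
      linarith
    · simp only [φ]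
      field_simp
      ring
  classical
  let hh : ℝ → S := fun t => if ht : φ t ∈ range f then (H.symm ⟨φ t, ht⟩ : S) else x₀
  have hgh : ∀ t ∈ Icc (-1 : ℝ) 1, g (hh t) = φ t := by
    intro t ht
    simp only [hh, hφ t ht, dif_pos]
    have := congrArg Subtype.val (H.apply_symm_apply ⟨φ t, hφ t ht⟩)
    exact this
  have hhK : ∀ t ∈ Icc (-1 : ℝ) 1, hh t ∈ Ks := by
    intro t ht
    simp only [hh, hφ t ht, dif_pos]
    exact Subtype.prop _
  refine ⟨Ks, mem_of_superset (hVo.mem_nhds hxV) hVK, hh, ?_, ?_, ?_, ?_⟩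
  · rw [continuousOn_iff_continuous_domRestrict]
    have : Continuous (fun t : Icc (-1 : ℝ) 1 => (H.symm ⟨φ t, hφ t t.2⟩ : S)) := by
      refine continuous_subtype_val.comp (H.symm.continuous.comp ?_)
      refine Continuous.subtype_mk ?_ _
      fun_prop
    convert! this using 1
    funext t
    simp only [hh, domRestrict_apply, hφ t t.2, dif_pos]
  · intro t ht t' ht' htt
    apply hφinj
    rw [← hgh t ht, ← hgh t' ht', htt]
  · apply Subset.antisymm
    · rintro _ ⟨t, ht, rfl⟩
      exact hhK t ht
    · intro y hy
      have : g y ∈ Icc α β := hI ▸ mem_image_of_mem g hy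
      obtain ⟨t, ht, e1⟩ := hφsurj (g y) this.1 this.2
      exact ⟨t, ht, hinj (by rw [hgh t ht, e1])⟩
  · have h1 : α < g x₀ := by linarith [m2.1]
    have h2 : g x₀ < β := by linarith [m1.2]
    obtain ⟨t, ht, e1⟩ := hφsurj (g x₀) h1.le h2.le
    refine ⟨t, ⟨lt_of_le_of_ne ht.1 ?_, lt_of_le_of_ne ht.2 ?_⟩, hinj (by rw [hgh t ht, e1])⟩
    · rintro rfl
      simp [φ] at e1; linarith
    · rintro rfl
      simp only [φ] at e1; linarith

/-- logarithms near the ends -/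
theorem TF.end_log {S : Type*} [TopologicalSpace S] {a b : S → ℂ} (ha : Continuous a)
    (hb : Continuous b) {p q : ℂ} (hpq : p ≠ q) (h1 : ∀ s, ‖a s - p‖ < ‖p - q‖ / 2)
    (h2 : ∀ s, ‖b s - q‖ < ‖p - q‖ / 2) :
    ∃ f : S × S → ℂ, Continuous f ∧ ∀ x, Complex.exp (f x) = a x.1 - b x.2 := by
  have hd : p - q ≠ 0 := sub_ne_zero.2 hpq
  have hn : 0 < ‖p - q‖ := norm_pos_iff.2 hd
  have hs : ∀ x : S × S, (a x.1 - b x.2) / (p - q) ∈ Complex.slitPlane := by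
    intro x
    have e1 : (a x.1 - b x.2) / (p - q) = 1 + ((a x.1 - p) - (b x.2 - q)) / (p - q) := by
      field_simp
      ring
    rw [e1]
    apply Complex.mem_slitPlane_of_norm_lt_one
    rw [norm_div, div_lt_one hn]
    have := norm_sub_le (a x.1 - p) (b x.2 - q)
    linarith [h1 x.1, h2 x.2]
  refine ⟨fun x => Complex.log ((a x.1 - b x.2) / (p - q)) + Complex.log (p - q), ?_, ?_⟩
  · refine Continuous.add (Continuous.clog (by fun_prop) hs) continuous_const
  · intro x
    have := Complex.slitPlane_ne_zero (hs x)
    rw [Complex.exp_add, Complex.exp_log this, Complex.exp_log hd, div_mul_cancel₀ _ hd]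


theorem TF.core {S : Type*} [TopologicalSpace S] {z : S × ℝ → ℂ} (hz : IsOpenEmbedding z)
    (x₀ : S) :
    ∃ Ks ∈ 𝓝 x₀, ∃ h : ℝ → S, ContinuousOn h (Icc (-1) 1) ∧ InjOn h (Icc (-1) 1) ∧
      h '' Icc (-1) 1 = Ks ∧ ∃ s₀ ∈ Ioo (-1 : ℝ) 1, h s₀ = x₀ := by
  have hzc := hz.continuous
  have hi : IsEmbedding (fun s : S => (s, (0 : ℝ))) := isEmbedding_prodMkLeft 0
  have he : IsEmbedding (fun s : S => z (s, 0)) := hz.isEmbedding.comp hi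
  have hT2 : T2Space S := he.t2Space
  have hlc : LocallyConnectedSpace (S × ℝ) := hz.locallyConnectedSpace
  have hLC : LocallyConnectedSpace S := by
    rw [locallyConnectedSpace_iff_subsets_isOpen_isConnected]
    intro s A hA
    have : Prod.fst ⁻¹' A ∈ 𝓝 (s, (0 : ℝ)) := continuous_fst.continuousAt.preimage_mem_nhds hA
    obtain ⟨V, hVA, hVo, hsV, hVc⟩ :=
      locallyConnectedSpace_iff_subsets_isOpen_isConnected.1 hlc (s, 0) _ this
    exact ⟨Prod.fst '' V, image_subset_iff.2 hVA, isOpenMap_fst _ hVo, ⟨_, hsV, rfl⟩,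
      hVc.image _ continuous_fst.continuousOn⟩
  have hlk : LocallyCompactSpace (S × ℝ) := hz.locallyCompactSpace
  have hLK : LocallyCompactSpace S := by
    refine IsClosedEmbedding.locallyCompactSpace (f := fun s : S => (s, (0 : ℝ))) ⟨hi, ?_⟩
    have : range (fun s : S => (s, (0 : ℝ))) = Prod.snd ⁻¹' {0} := by
      ext ⟨a, b⟩; simp [eq_comm]
    rw [this]
    exact isClosed_singleton.preimage continuous_snd
  have hne : ∀ t : ℝ, t ≠ 0 → z (x₀, t) ≠ z (x₀, 0) := fun t ht h0 =>
    ht (congrArg Prod.snd (hz.injective h0))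
  have hnb : ∀ (t r : ℝ), 0 < r → ∀ᶠ s in 𝓝 x₀, ‖z (s, t) - z (x₀, t)‖ < r := by
    intro t r hr
    have : Continuous (fun s => ‖z (s, t) - z (x₀, t)‖) := by fun_prop
    exact this.continuousAt.eventually_lt_const (by simpa using hr)
  have r1 : 0 < ‖z (x₀, 1) - z (x₀, 0)‖ / 2 :=
    half_pos (norm_pos_iff.2 (sub_ne_zero.2 (hne 1 one_ne_zero)))
  have r2 : 0 < ‖z (x₀, -1) - z (x₀, 0)‖ / 2 :=
    half_pos (norm_pos_iff.2 (sub_ne_zero.2 (hne (-1) (by norm_num))))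
  have hA := ((hnb 1 _ r1).and (hnb 0 _ r1)).and ((hnb (-1) _ r2).and (hnb 0 _ r2))
  obtain ⟨N, hNA, hNo, hxN, hNc⟩ :=
    locallyConnectedSpace_iff_subsets_isOpen_isConnected.1 hLC x₀ _ hA
  have hv : IsOpenEmbedding (Subtype.val : N → S) := hNo.isOpenEmbedding_subtypeVal
  have : LocallyConnectedSpace N := hv.locallyConnectedSpace
  have : LocallyCompactSpace N := hv.locallyCompactSpace
  have : PreconnectedSpace N := isPreconnected_iff_preconnectedSpace.1 hNc.isPreconnected
  let z' : N × ℝ → ℂ := fun q => z (q.1, q.2)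
  have hz' : IsOpenEmbedding z' := hz.comp (hv.prodMap IsOpenEmbedding.id)
  obtain ⟨P, Q, hPQ⟩ := TF.exists_order hz'
    (TF.end_log (a := fun s : N => z' (s, 1)) (b := fun s : N => z' (s, 0)) (by fun_prop)
      (by fun_prop) (hne 1 one_ne_zero) (fun s => (hNA s.2).1.1) (fun s => (hNA s.2).1.2))
    (TF.end_log (a := fun s : N => z' (s, -1)) (b := fun s : N => z' (s, 0)) (by fun_prop)
      (by fun_prop) (hne (-1) (by norm_num)) (fun s => (hNA s.2).2.1) (fun s => (hNA s.2).2.2))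
  obtain ⟨Ks, hKs, h, h1, h2, h3, s₀, hs₀, h4⟩ := TF.arc hPQ
    (hz'.isEmbedding.comp (isEmbedding_prodMkLeft (0 : ℝ))) ⟨x₀, hxN⟩
  refine ⟨Subtype.val '' Ks, ?_, fun t => (h t : S), ?_, ?_, ?_, s₀, hs₀, ?_⟩
  · exact hv.image_mem_nhds.2 hKs
  · exact continuous_subtype_val.comp_continuousOn h1
  · exact fun a ha b hb hab => h2 ha hb (Subtype.ext hab)
  · rw [← h3, image_image]
  · exact congrArg Subtype.val h4


theorem TF.locallyCompact {X : Type*} [TopologicalSpace X] [T2Space X]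
    (hman : ∀ x : X, ∃ U : Set X, IsOpen U ∧ x ∈ U ∧ Nonempty (↥U ≃ₜ (ℝ × ℝ))) :
    LocallyCompactSpace X := by
  have : WeaklyLocallyCompactSpace X := by
    refine ⟨fun x => ?_⟩
    obtain ⟨U, hU, hx, ⟨φ⟩⟩ := hman x
    have : LocallyCompactSpace U := φ.isOpenEmbedding.locallyCompactSpace
    obtain ⟨C, hC, hCx⟩ := exists_compact_mem_nhds (⟨x, hx⟩ : U)
    exact ⟨Subtype.val '' C, hC.image continuous_subtype_val,
      hU.isOpenEmbedding_subtypeVal.image_mem_nhds.2 hCx⟩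
  infer_instance

theorem TF.bebutov {X : Type*} [TopologicalSpace X] [T2Space X] [LocallyCompactSpace X]
    (ξ : ℝ → X → X)
    (hcont : Continuous (fun p : ℝ × X => ξ p.1 p.2))
    (hzero : ∀ x : X, ξ 0 x = x)
    (hadd : ∀ t s : ℝ, ∀ x : X, ξ (t + s) x = ξ t (ξ s x))
    (x₀ : X) (hx₀ : ∃ t : ℝ, ξ t x₀ ≠ x₀) :
    ∃ θ : X → ℝ, Continuous θ ∧ ∃ W : Set X, IsOpen W ∧ x₀ ∈ W ∧
      ∀ (x : X) (a b : ℝ), a < b → (∀ t ∈ Icc a b, ξ t x ∈ W) → θ (ξ a x) < θ (ξ b x) := by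
  obtain ⟨τ, hτ⟩ := hx₀
  obtain ⟨f, hf0, hf1, -⟩ := exists_continuous_zero_one_of_isCompact
    (isCompact_singleton (x := x₀)) (isClosed_singleton (x := ξ τ x₀))
    (by simpa using hτ.symm)
  have hf0 : f x₀ = 0 := hf0 rfl
  have hf1 : f (ξ τ x₀) = 1 := hf1 rfl
  have hc1 : ∀ t, Continuous (ξ t) := fun t =>
    hcont.comp (f := fun x => (t, x)) (by fun_prop)
  have hc2 : ∀ x, Continuous (fun t => ξ t x) := fun x =>
    hcont.comp (f := fun t => (t, x)) (by fun_prop)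
  let θ : X → ℝ := fun x => ∫ s in (0 : ℝ)..τ, f (ξ s x)
  have hθ : Continuous θ := by
    apply intervalIntegral.continuous_parametric_intervalIntegral_of_continuous'
    exact f.continuous.comp (hcont.comp (f := fun p : X × ℝ => (p.2, p.1)) (by fun_prop))
  refine ⟨θ, hθ, {x | f x < f (ξ τ x)}, isOpen_lt f.continuous (f.continuous.comp (hc1 τ)), ?_, ?_⟩
  · show f x₀ < f (ξ τ x₀)
    rw [hf0, hf1]; exact zero_lt_one
  · intro x a b hab hW
    let φ : ℝ → ℝ := fun t => f (ξ t x)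
    have hφ : Continuous φ := f.continuous.comp (hc2 x)
    have hIntg : ∀ a b : ℝ, IntervalIntegrable φ volume a b := fun a b => hφ.intervalIntegrable a b
    have hθt : ∀ t, θ (ξ t x) = (∫ s in (0 : ℝ)..(t + τ), φ s) - ∫ s in (0 : ℝ)..t, φ s := by
      intro t
      rw [intervalIntegral.integral_interval_sub_left (hIntg _ _) (hIntg _ _)]
      have : ∀ s, f (ξ s (ξ t x)) = φ (s + t) := fun s => by simp only [φ, hadd]
      simp only [θ, this]
      rw [intervalIntegral.integral_comp_add_right, zero_add, add_comm τ t]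
    have hd0 : ∀ t, HasDerivAt (fun t => ∫ s in (0 : ℝ)..t, φ s) (φ t) t := fun t =>
      intervalIntegral.integral_hasDerivAt_right (hIntg _ _)
        (hφ.stronglyMeasurableAtFilter _ _) hφ.continuousAt
    have hd : ∀ t, HasDerivAt (fun t => θ (ξ t x)) (φ (t + τ) - φ t) t := by
      intro t
      simp only [hθt]
      exact ((hd0 (t + τ)).comp_add_const t τ).sub (hd0 t)
    have hsm : StrictMonoOn (fun t => θ (ξ t x)) (Icc a b) := by
      apply strictMonoOn_of_deriv_pos (convex_Icc a b)
      · exact fun t _ => (hd t).continuousAt.continuousWithinAt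
      · intro t ht
        rw [(hd t).deriv]
        have := hW t (interior_subset ht)
        have h1 : f (ξ t x) < f (ξ τ (ξ t x)) := this
        rw [← hadd, add_comm] at h1
        exact sub_pos.2 h1
    exact hsm (left_mem_Icc.2 hab.le) (right_mem_Icc.2 hab.le) hab

theorem TF.flowbox {X : Type*} [TopologicalSpace X] [T2Space X] [LocallyCompactSpace X]
    (ξ : ℝ → X → X)
    (hcont : Continuous (fun p : ℝ × X => ξ p.1 p.2))
    (hzero : ∀ x : X, ξ 0 x = x)
    (hadd : ∀ t s : ℝ, ∀ x : X, ξ (t + s) x = ξ t (ξ s x))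
    (x₀ : X) (hx₀ : ∃ t : ℝ, ξ t x₀ ≠ x₀) (U : Set X) (hU : IsOpen U) (hxU : x₀ ∈ U) :
    ∃ S : Set X, ∃ δ > 0, x₀ ∈ S ∧ (∀ y ∈ S, ∀ t, |t| ≤ δ → ξ t y ∈ U) ∧
      (∀ y ∈ S, ∀ y' ∈ S, ∀ t t', |t| ≤ δ → |t'| ≤ δ → ξ t y = ξ t' y' → t = t' ∧ y = y') ∧
      (∀ s ∈ S, ∀ V ∈ 𝓝 s, ∀ ε > 0,
        {x | ∃ y ∈ S, y ∈ V ∧ ∃ t, |t| < ε ∧ ξ t y = x} ∈ 𝓝 s) := by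
  obtain ⟨θ, hθ, W, hWo, hxW, hmono⟩ := TF.bebutov ξ hcont hzero hadd x₀ hx₀
  have hc1 : ∀ t, Continuous (ξ t) := fun t =>
    hcont.comp (f := fun x => (t, x)) (by fun_prop)
  have hc2 : ∀ x, Continuous (fun t => ξ t x) := fun x =>
    hcont.comp (f := fun t => (t, x)) (by fun_prop)
  have hnear : ∀ (s : X) (V : Set X), V ∈ 𝓝 s → ∃ η > 0, ∃ A, IsOpen A ∧ s ∈ A ∧
      ∀ x ∈ A, ∀ t, |t| < η → ξ t x ∈ V := by
    intro s V hV
    have h1 : (fun p : ℝ × X => ξ p.1 p.2) ⁻¹' V ∈ 𝓝 ((0 : ℝ), s) := by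
      apply hcont.continuousAt.preimage_mem_nhds
      simpa [hzero] using hV
    rw [nhds_prod_eq, mem_prod_iff] at h1
    obtain ⟨B, hB, A, hA, hBA⟩ := h1
    obtain ⟨η, hη, hηB⟩ := Metric.mem_nhds_iff.1 hB
    obtain ⟨A', hA'A, hA'o, hsA'⟩ := mem_nhds_iff.1 hA
    refine ⟨η, hη, A', hA'o, hsA', fun x hx t ht => ?_⟩
    exact hBA (show (t, x) ∈ B ×ˢ A from ⟨hηB (by simpa [Real.dist_eq] using ht), hA'A hx⟩)
  obtain ⟨η, hη, W', hW'o, hxW', hW'⟩ := hnear x₀ (W ∩ U) ((hWo.inter hU).mem_nhds ⟨hxW, hxU⟩)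
  let δ := η / 3
  have hδ : 0 < δ := by simp only [δ]; linarith
  have hηδ : η = 3 * δ := by simp only [δ]; ring
  have key : ∀ y ∈ W', ∀ u, |u| < η → u ≠ 0 → θ (ξ u y) ≠ θ y := by
    intro y hy u hu hu0
    rw [abs_lt] at hu
    rcases lt_or_gt_of_ne hu0 with h | h
    · have := hmono y u 0 h (fun t ht => (hW' y hy t (abs_lt.2 ⟨by linarith [ht.1], by linarith [ht.2]⟩)).1)
      rw [hzero] at this
      exact this.ne
    · have := hmono y 0 u h (fun t ht => (hW' y hy t (abs_lt.2 ⟨by linarith [ht.1], by linarith [ht.2]⟩)).1)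
      rw [hzero] at this
      exact this.ne'
  refine ⟨{x | x ∈ W' ∧ θ x = θ x₀}, δ, hδ, ⟨hxW', rfl⟩, ?_, ?_, ?_⟩
  · rintro y ⟨hy, -⟩ t ht
    exact (hW' y hy t (by linarith)).2
  · rintro y ⟨hy, hy2⟩ y' ⟨hy', hy'2⟩ t t' ht ht' heq
    have e1 : ξ (t - t') y = y' := by
      have : ξ (-t') (ξ t y) = y' := by rw [heq, ← hadd, neg_add_cancel, hzero]
      rw [← this, ← hadd]; congr 1; ring
    have e2 : t - t' = 0 := by
      by_contra hne
      refine key y hy (t - t') ?_ hne ?_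
      · rw [abs_le] at ht ht'
        rw [abs_lt]; constructor <;> linarith [ht.1, ht.2, ht'.1, ht'.2]
      · rw [e1, hy2, hy'2]
    refine ⟨sub_eq_zero.1 e2, ?_⟩
    rw [← e1, e2, hzero]
  · rintro s ⟨hs, hs2⟩ V hV ε hε
    obtain ⟨η₁, hη₁, A, hAo, hsA, hA⟩ := hnear s (V ∩ W') (inter_mem hV (hW'o.mem_nhds hs))
    let κ := min (min ε δ) η₁ / 2
    have hm : 0 < min (min ε δ) η₁ := lt_min (lt_min hε hδ) hη₁
    have hκ : 0 < κ := half_pos hm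
    have hκ1 : κ < ε := by
      have := (min_le_left (min ε δ) η₁).trans (min_le_left _ _)
      simp only [κ]; linarith
    have hκ2 : κ < δ := by
      have := (min_le_left (min ε δ) η₁).trans (min_le_right _ _)
      simp only [κ]; linarith
    have hκ3 : κ < η₁ := by
      have := (min_le_right (min ε δ) η₁)
      simp only [κ]; linarith
    have m1 : θ (ξ (-κ) s) < θ x₀ := by
      have := hmono s (-κ) 0 (by linarith) (fun t ht => (hW' s hs t (abs_lt.2 ⟨by linarith [ht.1], by linarith [ht.2]⟩)).1)
      rwa [hzero, hs2] at this
    have m2 : θ x₀ < θ (ξ κ s) := by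
      have := hmono s 0 κ (by linarith) (fun t ht => (hW' s hs t (abs_lt.2 ⟨by linarith [ht.1], by linarith [ht.2]⟩)).1)
      rwa [hzero, hs2] at this
    filter_upwards [hAo.mem_nhds hsA,
      (hθ.comp (hc1 (-κ))).continuousAt.eventually_lt_const m1,
      (hθ.comp (hc1 κ)).continuousAt.eventually_const_lt m2] with x hx a1 a2
    obtain ⟨t, ht, e1⟩ := intermediate_value_Icc (show -κ ≤ κ by linarith)
      (hθ.comp (hc2 x)).continuousOn ⟨a1.le, a2.le⟩
    have hta : |t| ≤ κ := abs_le.2 ht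
    have hm := hA x hx t (by linarith)
    refine ⟨ξ t x, ⟨hm.2, e1⟩, hm.1, -t, by rw [abs_neg]; linarith, ?_⟩
    rw [← hadd, neg_add_cancel, hzero]

theorem TF.box_embedding {X : Type*} [TopologicalSpace X] (ξ : ℝ → X → X)
    (hcont : Continuous (fun p : ℝ × X => ξ p.1 p.2))
    (hzero : ∀ x : X, ξ 0 x = x)
    (hadd : ∀ t s : ℝ, ∀ x : X, ξ (t + s) x = ξ t (ξ s x))
    {S : Set X} {δ : ℝ} (hδ : 0 < δ)
    (hinj : ∀ y ∈ S, ∀ y' ∈ S, ∀ t t', |t| ≤ δ → |t'| ≤ δ → ξ t y = ξ t' y' → t = t' ∧ y = y')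
    (hnb : ∀ s ∈ S, ∀ V ∈ 𝓝 s, ∀ ε > 0,
        {x | ∃ y ∈ S, y ∈ V ∧ ∃ t, |t| < ε ∧ ξ t y = x} ∈ 𝓝 s) :
    ∃ κ : ℝ → ℝ, (∀ t, |κ t| ≤ δ) ∧
      IsOpenEmbedding (fun q : S × ℝ => ξ (κ q.2) q.1) := by
  have hpi := Real.pi_pos
  let c := δ * (2 / Real.pi)
  have hc : 0 < c := by positivity
  have hcd : c * (Real.pi / 2) = δ := by simp only [c]; field_simp
  let κ : ℝ → ℝ := fun t => c * Real.arctan t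
  have hκc : Continuous κ := by fun_prop
  have hκ : ∀ t, |κ t| ≤ δ := by
    intro t
    have h1 := Real.neg_pi_div_two_lt_arctan t
    have h2 := Real.arctan_lt_pi_div_two t
    have h3 : |Real.arctan t| ≤ Real.pi / 2 := abs_le.2 ⟨by linarith, h2.le⟩
    calc |κ t| = c * |Real.arctan t| := by simp only [κ]; rw [abs_mul, abs_of_pos hc]
      _ ≤ c * (Real.pi / 2) := mul_le_mul_of_nonneg_left h3 hc.le
      _ = δ := hcd
  have hκi : Function.Injective κ := fun a b hab =>
    Real.arctan_injective (mul_left_cancel₀ hc.ne' hab)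
  have hκo : ∀ t, ∀ B ∈ 𝓝 t, κ '' B ∈ 𝓝 (κ t) := by
    intro t B hB
    have e1 : κ t / c = Real.arctan t := by simp only [κ]; field_simp
    have h1 : ContinuousAt (fun u => Real.tan (u / c)) (κ t) := by
      refine ContinuousAt.comp (g := Real.tan) (f := fun u => u / c) ?_ (by fun_prop)
      rw [e1]
      exact Real.continuousAt_tan.2 (Real.cos_arctan_pos t).ne'
    have h2 : ∀ᶠ u in 𝓝 (κ t), Real.tan (u / c) ∈ B := by
      apply h1.eventually
      beta_reduce
      rw [e1, Real.tan_arctan]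
      exact hB
    have hdc : Continuous (fun u : ℝ => u / c) := by fun_prop
    have h3 : ∀ᶠ u in 𝓝 (κ t), u / c ∈ Ioo (-(Real.pi / 2)) (Real.pi / 2) := by
      apply hdc.continuousAt.eventually
      beta_reduce
      rw [e1]
      exact Ioo_mem_nhds (Real.neg_pi_div_two_lt_arctan t) (Real.arctan_lt_pi_div_two t)
    filter_upwards [h2, h3] with u a1 a2
    refine ⟨_, a1, ?_⟩
    simp only [κ]
    rw [Real.arctan_tan a2.1 a2.2]
    field_simp
  refine ⟨κ, hκ, ?_⟩
  apply IsOpenEmbedding.of_continuous_injective_isOpenMap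
  · exact hcont.comp (f := fun q : S × ℝ => (κ q.2, (q.1 : X))) (by fun_prop)
  · rintro ⟨y, t⟩ ⟨y', t'⟩ heq
    obtain ⟨h1, h2⟩ := hinj y y.2 y' y'.2 _ _ (hκ t) (hκ t') heq
    exact Prod.ext (Subtype.ext h2) (hκi h1)
  · apply IsOpenMap.of_nhds_le
    rintro ⟨y, t⟩ N hN
    rw [mem_map, nhds_prod_eq, mem_prod_iff] at hN
    obtain ⟨A, hA, B, hB, hAB⟩ := hN
    obtain ⟨V, hV, hVA⟩ := mem_nhds_subtype S y A |>.1 hA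
    obtain ⟨ε, hε, hεB⟩ := Metric.mem_nhds_iff.1 (hκo t B hB)
    have h1 := hnb y y.2 V hV ε hε
    have hct : Continuous (ξ (-κ t)) := hcont.comp (f := fun x => (-κ t, x)) (by fun_prop)
    have h2 : ∀ᶠ x in 𝓝 (ξ (κ t) y), ξ (-κ t) x ∈
        {x | ∃ y ∈ S, y ∈ V ∧ ∃ t, |t| < ε ∧ ξ t y = x} := by
      apply hct.continuousAt.eventually
      rw [← hadd, neg_add_cancel, hzero]
      exact h1
    filter_upwards [h2] with x hx
    obtain ⟨y', hy'S, hy'V, u, hu, hux⟩ := hx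
    obtain ⟨t', ht', ht'e⟩ := hεB (show κ t + u ∈ Metric.ball (κ t) ε by
      simpa [Real.dist_eq] using hu)
    have hm : ((⟨y', hy'S⟩ : S), t') ∈ A ×ˢ B := ⟨hVA hy'V, ht'⟩
    have h3 := hAB hm
    have h4 : ξ (κ t') y' = x := by
      rw [ht'e, hadd, hux, ← hadd, add_neg_cancel, hzero]
    have h5 : ξ (κ t') y' ∈ N := h3
    rwa [h4] at h5

/-- **Hájek's theorem**: for a flow on a two-dimensional topological manifold, every
non-stationary point admits an `ε`-transversal for all sufficiently small `ε > 0`. -/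
theorem exists_transversal_of_flow_on_surface
    {X : Type*} [TopologicalSpace X] [T2Space X]
    (hman : ∀ x : X, ∃ U : Set X, IsOpen U ∧ x ∈ U ∧ Nonempty (↥U ≃ₜ (ℝ × ℝ)))
    (ξ : ℝ → X → X)
    (hcont : Continuous (fun p : ℝ × X => ξ p.1 p.2))
    (hzero : ∀ x : X, ξ 0 x = x)
    (hadd : ∀ t s : ℝ, ∀ x : X, ξ (t + s) x = ξ t (ξ s x))
    (x₀ : X) (hx₀ : ∃ t : ℝ, ξ t x₀ ≠ x₀) :
    ∃ ε₀ : ℝ, 0 < ε₀ ∧ ∀ ε : ℝ, 0 < ε → ε ≤ ε₀ →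
      ∃ T : Set X, IsTransversalOn (Set.univ : Set X) ξ ε x₀ T := by
  have hLC : LocallyCompactSpace X := TF.locallyCompact hman
  obtain ⟨U, hU, hxU, ⟨φ⟩⟩ := hman x₀
  obtain ⟨S, δ, hδ, hxS, hSU, hinj, hnb⟩ :=
    TF.flowbox ξ hcont hzero hadd x₀ hx₀ U hU hxU
  obtain ⟨κ, hκ, hemb⟩ := TF.box_embedding ξ hcont hzero hadd hδ hinj hnb
  let F : S × ℝ → U := fun q => ⟨ξ (κ q.2) q.1, hSU q.1 q.1.2 _ (hκ q.2)⟩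
  have hF : IsOpenEmbedding F :=
    IsOpenEmbedding.of_comp F hU.isOpenEmbedding_subtypeVal hemb
  let ψ : (ℝ × ℝ) ≃ₜ ℂ := Complex.equivRealProdCLM.symm.toHomeomorph
  have hz : IsOpenEmbedding (fun q => ψ (φ (F q))) :=
    ψ.isOpenEmbedding.comp (φ.isOpenEmbedding.comp hF)
  obtain ⟨Ks, hKs, h, h1, h2, h3, s₀, hs₀, h4⟩ := TF.core hz ⟨x₀, hxS⟩
  obtain ⟨V, hV, hVK⟩ := mem_nhds_subtype S ⟨x₀, hxS⟩ Ks |>.1 hKs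
  refine ⟨δ, hδ, fun ε hε hεδ => ⟨Subtype.val '' Ks, ?_, ?_⟩⟩
  · refine ⟨⟨⟨x₀, hxS⟩, mem_of_mem_nhds hKs, rfl⟩, subset_univ _, ?_, ?_⟩
    · obtain ⟨W, hW, hWo, hxW⟩ := mem_nhds_iff.1 (hnb x₀ hxS V hV ε hε)
      refine ⟨W, hWo, hxW, ?_⟩
      rintro x ⟨hx, -⟩
      obtain ⟨y, hyS, hyV, t, ht, hty⟩ := hW hx
      simp only [mem_iUnion]
      exact ⟨t, abs_le.1 ht.le, y, ⟨⟨y, hyS⟩, hVK hyV, rfl⟩, hty⟩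
    · intro x hx
      simp only [mem_iUnion] at hx
      obtain ⟨t, ht, y, hy, hty⟩ := hx
      refine ⟨(t, y), ⟨ht, hy, hty⟩, ?_⟩
      rintro ⟨t', y'⟩ ⟨ht', hy', hty'⟩
      obtain ⟨⟨y, hyS⟩, hyK, rfl⟩ := hy
      obtain ⟨⟨y', hyS'⟩, hyK', rfl⟩ := hy'
      obtain ⟨e1, e2⟩ := hinj y' hyS' y hyS t' t ((abs_le.2 ht').trans hεδ)
        ((abs_le.2 ht).trans hεδ) (hty'.trans hty.symm)
      exact Prod.ext e1 e2
  · refine ⟨fun t => (h t : X), continuous_subtype_val.comp_continuousOn h1,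
      fun a ha b hb hab => h2 ha hb (Subtype.ext hab), ?_, s₀, hs₀, congrArg Subtype.val h4⟩
    rw [← h3, image_image]
end
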